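/- arXiv:1109.2368 — 2 statements merged into one kernel-verified Lean document; each statement's English description precedes it below -/
import Mathlib

section
/- Let A be a finite point configuration in ℝ^d, ω ∈ ℝ^A a weight vector, and Δ_ω the regular subdivision of A induced by ω. Let F_ω be the face of the secondary polytope Σ(A) on which the linear functional ω is minimized. Then F_ω equals the Minkowski sum of the secondary polytopes of the maximal cells of Δ_ω (each embedded in ℝ^A by extending GKZ-vectors by zero). -/
open scoped Pointwise Classical

/-- The dimension of the convex hull of the points of `C` (affine span dimension). -/
noncomputable def convDim {d m : ℕ} (a : Fin m → (Fin d → ℝ)) (C : Finset (Fin m)) : ℕ :=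
  Module.finrank ℝ ↥(vectorSpan ℝ (a '' ↑C))

/-- `T` is a triangulation of the subconfiguration `C` of the point configuration `a`:
a family of full-dimensional affinely independent cells contained in `C`, whose convex
hulls cover `conv C` and pairwise intersect in common faces, with matching marked
points. -/
def IsTriangulation {d m : ℕ} (a : Fin m → (Fin d → ℝ)) (C : Finset (Fin m))
    (T : Finset (Finset (Fin m))) : Prop :=
  (∀ σ ∈ T, σ ⊆ C ∧ σ.card = convDim a C + 1 ∧
      AffineIndependent ℝ (fun i : ↥(↑σ : Set (Fin m)) => a ↑i)) ∧
  (convexHull ℝ (a '' ↑C) = ⋃ σ ∈ T, convexHull ℝ (a '' ↑σ)) ∧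
  (∀ σ ∈ T, ∀ τ ∈ T,
    IsExtreme ℝ (convexHull ℝ (a '' ↑σ))
      (convexHull ℝ (a '' ↑σ) ∩ convexHull ℝ (a '' ↑τ)) ∧
    IsExtreme ℝ (convexHull ℝ (a '' ↑τ))
      (convexHull ℝ (a '' ↑σ) ∩ convexHull ℝ (a '' ↑τ)) ∧
    ((↑σ : Set (Fin m)) ∩ {i | a i ∈ convexHull ℝ (a '' ↑τ)} =
      (↑τ : Set (Fin m)) ∩ {i | a i ∈ convexHull ℝ (a '' ↑σ)}))

/-- The GKZ-vector of a triangulation `T`: its coordinate at `i` is the sum of the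
volumes of the maximal cells of `T` containing `i` (zero on points not in any cell). -/
noncomputable def gkzVector {d m : ℕ} (a : Fin m → (Fin d → ℝ))
    (T : Finset (Finset (Fin m))) : Fin m → ℝ :=
  fun i => ∑ σ ∈ T,
    if i ∈ σ then (MeasureTheory.volume (convexHull ℝ (a '' ↑σ))).toReal else 0

/-- The secondary polytope of the subconfiguration `C` of `a`, embedded in `ℝ^m` by
extending GKZ-vectors by zero: the convex hull of the GKZ-vectors of all triangulations
of `C`. -/
noncomputable def secondaryPolytope {d m : ℕ} (a : Fin m → (Fin d → ℝ))
    (C : Finset (Fin m)) : Set (Fin m → ℝ) :=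
  convexHull ℝ {φ | ∃ T : Finset (Finset (Fin m)), IsTriangulation a C T ∧ φ = gkzVector a T}

/-- `C` is a maximal cell of the regular subdivision of `a` induced by `ω`: it is the
set of labels lifted to a common lower face (the argmin cell picked out by some
`x ∈ ℝ^d`), and its convex hull has the same dimension as that of the whole
configuration. -/
def IsMaxCell {d m : ℕ} (a : Fin m → (Fin d → ℝ)) (ω : Fin m → ℝ)
    (C : Finset (Fin m)) : Prop :=
  (∃ x : Fin d → ℝ, (↑C : Set (Fin m)) =
      {i | ∀ j, ω i + ∑ t, a i t * x t ≤ ω j + ∑ t, a j t * x t}) ∧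
  convDim a C = convDim a Finset.univ


section AffineHelpers

variable {d m : ℕ}

lemma aff_nonneg_on_hull (a : Fin m → (Fin d → ℝ)) (D : Finset (Fin m))
    (h : (Fin d → ℝ) →ᵃ[ℝ] ℝ) (hD : ∀ i ∈ D, 0 ≤ h (a i)) (q : Fin d → ℝ)
    (hq : q ∈ convexHull ℝ (a '' ↑D)) : 0 ≤ h q := by
  have hc : Convex ℝ (h ⁻¹' Set.Ici 0) := (convex_Ici (0 : ℝ)).affine_preimage h
  have : convexHull ℝ (a '' ↑D) ⊆ h ⁻¹' Set.Ici 0 := by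
    refine convexHull_min ?_ hc
    rintro _ ⟨i, hi, rfl⟩
    exact hD i hi
  exact this hq

lemma aff_le_on_hull (a : Fin m → (Fin d → ℝ)) (D : Finset (Fin m))
    (f g : (Fin d → ℝ) →ᵃ[ℝ] ℝ) (hD : ∀ i ∈ D, f (a i) ≤ g (a i)) (q : Fin d → ℝ)
    (hq : q ∈ convexHull ℝ (a '' ↑D)) : f q ≤ g q := by
  have := aff_nonneg_on_hull a D (g - f) (fun i hi => by simpa using hD i hi) q hq
  simpa using this

lemma aff_eq_on_hull (a : Fin m → (Fin d → ℝ)) (D : Finset (Fin m))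
    (f g : (Fin d → ℝ) →ᵃ[ℝ] ℝ) (hD : ∀ i ∈ D, f (a i) = g (a i)) (q : Fin d → ℝ)
    (hq : q ∈ convexHull ℝ (a '' ↑D)) : f q = g q :=
  le_antisymm (aff_le_on_hull a D f g (fun i hi => (hD i hi).le) q hq)
    (aff_le_on_hull a D g f (fun i hi => (hD i hi).ge) q hq)

lemma hull_zero_face_set {E : Type*} [AddCommGroup E] [Module ℝ E] (S : Set E)
    (h : E →ᵃ[ℝ] ℝ) (hS : ∀ x ∈ S, 0 ≤ h x) (q : E)
    (hq : q ∈ convexHull ℝ S) (h0 : h q = 0) :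
    q ∈ convexHull ℝ {x | x ∈ S ∧ h x = 0} := by
  set K := convexHull ℝ {x | x ∈ S ∧ h x = 0} with hK
  have hKc : Convex ℝ K := convex_convexHull ℝ _
  have hKz : ∀ x ∈ K, h x = 0 := by
    intro x hx
    have : K ⊆ h ⁻¹' {0} := by
      refine convexHull_min ?_ ((convex_singleton (0 : ℝ)).affine_preimage h)
      intro x hx
      exact hx.2
    exact this hx
  have hconv : Convex ℝ {x | 0 < h x ∨ x ∈ K} := by
    intro x hx y hy s t hs ht hst
    have hval : h (s • x + t • y) = s * h x + t * h y := by
      have := Convex.combo_affine_apply (f := h) (x := x) (y := y) hst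
      simpa using this
    have nx : 0 ≤ h x := hx.elim le_of_lt (fun hx => (hKz x hx).ge)
    have ny : 0 ≤ h y := hy.elim le_of_lt (fun hy => (hKz y hy).ge)
    rcases hs.eq_or_lt with rfl | hs'
    · have : t = 1 := by linarith
      subst this
      simpa using hy
    rcases ht.eq_or_lt with rfl | ht'
    · have : s = 1 := by linarith
      subst this
      simpa using hx
    rcases hx with hx | hx
    · left
      rw [hval]
      have := mul_pos hs' hx
      have := mul_nonneg ht ny
      linarith
    rcases hy with hy | hy
    · left
      rw [hval]
      have := mul_pos ht' hy
      have := mul_nonneg hs nx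
      linarith
    right
    exact hKc hx hy hs ht hst
  have hsub : convexHull ℝ S ⊆ {x | 0 < h x ∨ x ∈ K} := by
    refine convexHull_min ?_ hconv
    intro i hi
    rcases (hS i hi).eq_or_lt with h1 | h1
    · right
      exact subset_convexHull ℝ _ ⟨hi, h1.symm⟩
    · left
      exact h1
  rcases hsub hq with h1 | h1
  · rw [h0] at h1
    exact absurd h1 (lt_irrefl _)
  · exact h1

lemma hull_zero_face (a : Fin m → (Fin d → ℝ)) (D : Finset (Fin m))
    (h : (Fin d → ℝ) →ᵃ[ℝ] ℝ) (hD : ∀ i ∈ D, 0 ≤ h (a i)) (q : Fin d → ℝ)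
    (hq : q ∈ convexHull ℝ (a '' ↑D)) (h0 : h q = 0) :
    q ∈ convexHull ℝ (a '' {i | i ∈ D ∧ h (a i) = 0}) := by
  refine convexHull_mono ?_ (hull_zero_face_set (a '' ↑D) h ?_ q hq h0)
  · rintro _ ⟨⟨i, hi, rfl⟩, hz⟩
    exact ⟨i, ⟨hi, hz⟩, rfl⟩
  · rintro _ ⟨i, hi, rfl⟩
    exact hD i hi

/-- The affine function `l` lies below the lifted points of `C`. -/
def Feas (a : Fin m → (Fin d → ℝ)) (C : Finset (Fin m)) (ω : Fin m → ℝ)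
    (l : (Fin d → ℝ) →ᵃ[ℝ] ℝ) : Prop := ∀ i ∈ C, l (a i) ≤ ω i

/-- The labels of `C` at which `l` touches the lifted points. -/
noncomputable def tightCell (a : Fin m → (Fin d → ℝ)) (C : Finset (Fin m)) (ω : Fin m → ℝ)
    (l : (Fin d → ℝ) →ᵃ[ℝ] ℝ) : Finset (Fin m) := C.filter (fun i => l (a i) = ω i)

/-- `D` affinely spans `C`, tested by affine functions. -/
def FullRank (a : Fin m → (Fin d → ℝ)) (C D : Finset (Fin m)) : Prop :=
  ∀ h : (Fin d → ℝ) →ᵃ[ℝ] ℝ, (∀ i ∈ D, h (a i) = 0) → ∀ i ∈ C, h (a i) = 0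

lemma mem_tightCell {a : Fin m → (Fin d → ℝ)} {C : Finset (Fin m)} {ω : Fin m → ℝ}
    {l : (Fin d → ℝ) →ᵃ[ℝ] ℝ} {i : Fin m} :
    i ∈ tightCell a C ω l ↔ i ∈ C ∧ l (a i) = ω i := by simp [tightCell]

lemma tightCell_subset (a : Fin m → (Fin d → ℝ)) (C : Finset (Fin m)) (ω : Fin m → ℝ)
    (l : (Fin d → ℝ) →ᵃ[ℝ] ℝ) : tightCell a C ω l ⊆ C := Finset.filter_subset _ _

/-- Moving a feasible function along `h` until a new constraint becomes tight. -/
lemma push_step (a : Fin m → (Fin d → ℝ)) (C : Finset (Fin m)) (ω : Fin m → ℝ)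
    (l h : (Fin d → ℝ) →ᵃ[ℝ] ℝ) (hl : Feas a C ω l)
    (hz : ∀ i ∈ tightCell a C ω l, h (a i) = 0) (hpos : ∃ i ∈ C, 0 < h (a i)) :
    ∃ t : ℝ, 0 ≤ t ∧ Feas a C ω (l + t • h) ∧
      tightCell a C ω l ⊂ tightCell a C ω (l + t • h) := by
  set P := C.filter (fun i => 0 < h (a i)) with hP
  have hPne : P.Nonempty := by
    obtain ⟨i, hi, hi'⟩ := hpos
    exact ⟨i, by simp [hP, hi, hi']⟩
  obtain ⟨k, hk, hmin⟩ := P.exists_min_image (fun i => (ω i - l (a i)) / h (a i)) hPne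
  have hkC : k ∈ C := (Finset.mem_filter.1 hk).1
  have hkp : 0 < h (a k) := (Finset.mem_filter.1 hk).2
  set t := (ω k - l (a k)) / h (a k) with ht
  have ht0 : 0 ≤ t := div_nonneg (by linarith [hl k hkC]) hkp.le
  have hval : ∀ i, (l + t • h) (a i) = l (a i) + t * h (a i) := by
    intro i; simp
  refine ⟨t, ht0, ?_, ?_⟩
  · intro i hi
    rw [hval]
    rcases le_or_gt (h (a i)) 0 with h1 | h1
    · have := mul_nonpos_of_nonneg_of_nonpos ht0 h1
      linarith [hl i hi]
    · have h2 := hmin i (Finset.mem_filter.2 ⟨hi, h1⟩)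
      rw [le_div_iff₀ h1] at h2
      linarith
  · rw [Finset.ssubset_iff_of_subset]
    · refine ⟨k, ?_, ?_⟩
      · rw [mem_tightCell, hval]
        refine ⟨hkC, ?_⟩
        rw [ht, div_mul_cancel₀ _ hkp.ne']
        ring
      · intro hk'
        exact hkp.ne' (hz k hk')
    · intro i hi
      have h0 := hz i hi
      rw [mem_tightCell] at hi ⊢
      refine ⟨hi.1, ?_⟩
      rw [hval, h0, hi.2]
      ring

lemma push (a : Fin m → (Fin d → ℝ)) (C : Finset (Fin m)) (ω : Fin m → ℝ)
    (p : Fin d → ℝ) (hp : p ∈ convexHull ℝ (a '' ↑C)) :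
    ∀ (n : ℕ) (l : (Fin d → ℝ) →ᵃ[ℝ] ℝ), Feas a C ω l →
      C.card - (tightCell a C ω l).card ≤ n →
      ∃ l' : (Fin d → ℝ) →ᵃ[ℝ] ℝ, Feas a C ω l' ∧ FullRank a C (tightCell a C ω l') ∧
        l p ≤ l' p := by
  intro n
  induction n with
  | zero =>
    intro l hl hc
    refine ⟨l, hl, ?_, le_rfl⟩
    have : tightCell a C ω l = C :=
      Finset.eq_of_subset_of_card_le (tightCell_subset a C ω l) (by omega)
    rw [this]
    exact fun h hh => hh
  | succ n ih =>
    intro l hl hc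
    by_cases hF : FullRank a C (tightCell a C ω l)
    · exact ⟨l, hl, hF, le_rfl⟩
    unfold FullRank at hF
    push Not at hF
    obtain ⟨h, hz, j, hj, hjn⟩ := hF
    have key : ∃ h' : (Fin d → ℝ) →ᵃ[ℝ] ℝ, (∀ i ∈ tightCell a C ω l, h' (a i) = 0) ∧
        0 ≤ h' p ∧ ∃ i ∈ C, 0 < h' (a i) := by
      have general : ∀ g : (Fin d → ℝ) →ᵃ[ℝ] ℝ, 0 < g p → ∃ i ∈ C, 0 < g (a i) := by
        intro g hg
        by_contra hcon
        push Not at hcon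
        have := aff_nonneg_on_hull a C (-g) (fun i hi => by simpa using hcon i hi) p hp
        simp at this
        linarith
      rcases lt_trichotomy (h p) 0 with h1 | h1 | h1
      · have h1' : 0 < (-h) p := by simpa using h1
        exact ⟨-h, fun i hi => by simp [hz i hi], h1'.le, general _ h1'⟩
      · rcases lt_or_gt_of_ne hjn with h2 | h2
        · exact ⟨-h, fun i hi => by simp [hz i hi], by simp [h1], j, hj, by simpa using h2⟩
        · exact ⟨h, hz, h1.ge, j, hj, h2⟩
      · exact ⟨h, hz, h1.le, general _ h1⟩
    obtain ⟨h', hz', hp', hpos⟩ := key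
    obtain ⟨t, ht, hf, hss⟩ := push_step a C ω l h' hl hz' hpos
    have hcard := Finset.card_lt_card hss
    have hle := Finset.card_le_card (tightCell_subset a C ω (l + t • h'))
    obtain ⟨l', h1, h2, h3⟩ := ih (l + t • h') hf (by omega)
    refine ⟨l', h1, h2, le_trans ?_ h3⟩
    have := mul_nonneg ht hp'
    simp
    linarith

lemma exists_feas (a : Fin m → (Fin d → ℝ)) (C : Finset (Fin m)) (ω : Fin m → ℝ) :
    ∃ l, Feas a C ω l := by
  rcases C.eq_empty_or_nonempty with rfl | hC
  · exact ⟨0, by simp [Feas]⟩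
  obtain ⟨k, _, hk⟩ := C.exists_min_image ω hC
  exact ⟨AffineMap.const ℝ _ (ω k), fun i hi => by simpa using hk i hi⟩

/-- Full-rank cells of the regular subdivision cover the convex hull. -/
lemma cells_cover (a : Fin m → (Fin d → ℝ)) (C : Finset (Fin m)) (ω : Fin m → ℝ)
    (p : Fin d → ℝ) (hp : p ∈ convexHull ℝ (a '' ↑C)) :
    ∃ l, Feas a C ω l ∧ FullRank a C (tightCell a C ω l) ∧
      p ∈ convexHull ℝ (a '' ↑(tightCell a C ω l)) := by
  obtain ⟨l₀, hl₀⟩ := exists_feas a C ω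
  obtain ⟨l₁, hl₁, hr₁, -⟩ := push a C ω p hp _ l₀ hl₀ le_rfl
  set V : Set ℝ := {v | ∃ l, Feas a C ω l ∧ FullRank a C (tightCell a C ω l) ∧ l p = v} with hV
  have hVfin : V.Finite := by
    refine Set.Finite.subset (Set.finite_range (fun D : Finset (Fin m) =>
      if h : ∃ l, Feas a C ω l ∧ FullRank a C (tightCell a C ω l) ∧ D = tightCell a C ω l
      then h.choose p else 0)) ?_
    rintro v ⟨l, hl, hr, rfl⟩
    refine ⟨tightCell a C ω l, ?_⟩
    have h : ∃ l', Feas a C ω l' ∧ FullRank a C (tightCell a C ω l') ∧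
      tightCell a C ω l = tightCell a C ω l' := ⟨l, hl, hr, rfl⟩
    simp only [dif_pos h]
    obtain ⟨h1, h2, h3⟩ := h.choose_spec
    refine aff_eq_on_hull a C _ _ ?_ p hp
    intro i hi
    have := hr (h.choose - l) (fun j hj => by
      have e1 := (mem_tightCell.1 hj).2
      have hj' := hj
      rw [h3] at hj'
      have e2 := (mem_tightCell.1 hj').2
      simp [e1, e2]) i hi
    have h4 : h.choose (a i) - l (a i) = 0 := by simpa using this
    linarith
  have hVne : V.Nonempty := ⟨l₁ p, l₁, hl₁, hr₁, rfl⟩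
  obtain ⟨v, ⟨l, hl, hr, rfl⟩, hmax⟩ := hVfin.exists_maximal hVne
  refine ⟨l, hl, hr, ?_⟩
  by_contra hnot
  have hcl : IsClosed (convexHull ℝ (a '' ↑(tightCell a C ω l))) :=
    ((Finset.finite_toSet _).image a).isClosed_convexHull ℝ
  obtain ⟨f, u, hf, hu⟩ := geometric_hahn_banach_closed_point (convex_convexHull ℝ _) hcl hnot
  set h : (Fin d → ℝ) →ᵃ[ℝ] ℝ :=
    (f : (Fin d → ℝ) →ₗ[ℝ] ℝ).toAffineMap - AffineMap.const ℝ _ u with hh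
  have hhv : ∀ q, h q = f q - u := fun q => by simp [hh]
  have hev : ∀ᶠ t in nhdsWithin (0 : ℝ) (Set.Ioi 0), ∀ i ∈ C, l (a i) + t * h (a i) ≤ ω i := by
    rw [Filter.eventually_all_finset]
    intro i hi
    by_cases hti : l (a i) = ω i
    · have : h (a i) < 0 := by
        rw [hhv]
        have := hf (a i) (subset_convexHull ℝ _ ⟨i, mem_tightCell.2 ⟨hi, hti⟩, rfl⟩)
        linarith
      filter_upwards [self_mem_nhdsWithin] with t ht
      have := mul_neg_of_pos_of_neg ht this
      linarith
    · have hlt : l (a i) < ω i := lt_of_le_of_ne (hl i hi) hti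
      have hc : Continuous (fun t : ℝ => l (a i) + t * h (a i)) := by fun_prop
      have : ∀ᶠ t in nhds (0 : ℝ), l (a i) + t * h (a i) < ω i :=
        (hc.tendsto 0).eventually_lt_const (by simpa using hlt)
      filter_upwards [nhdsWithin_le_nhds this] with t ht using ht.le
  obtain ⟨t, ht, htpos⟩ := (hev.and self_mem_nhdsWithin).exists
  have htp : (0 : ℝ) < t := htpos
  obtain ⟨l', h1, h2, h3⟩ := push a C ω p hp _ (l + t • h) (fun i hi => by simpa using ht i hi) le_rfl
  have hgt : l p < l' p := by
    refine lt_of_lt_of_le ?_ h3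
    have : 0 < t * h p := mul_pos htp (by rw [hhv]; linarith)
    simpa using this
  have := hmax ⟨l', h1, h2, rfl⟩ hgt.le
  linarith

end AffineHelpers

section Regular

variable {d m : ℕ}

lemma FullRank.nonempty {a : Fin m → (Fin d → ℝ)} {C D : Finset (Fin m)}
    (h : FullRank a C D) (hC : C.Nonempty) : D.Nonempty := by
  by_contra hD
  rw [Finset.not_nonempty_iff_eq_empty] at hD
  subst hD
  obtain ⟨i, hi⟩ := hC
  have := h (AffineMap.const ℝ _ 1) (by simp) i hi
  simp at this

lemma FullRank.convDim_eq {a : Fin m → (Fin d → ℝ)} {C D : Finset (Fin m)}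
    (h : FullRank a C D) (hDC : D ⊆ C) : convDim a D = convDim a C := by
  rcases C.eq_empty_or_nonempty with rfl | hC
  · rw [Finset.subset_empty.1 hDC]
  have hle : vectorSpan ℝ (a '' ↑D) ≤ vectorSpan ℝ (a '' ↑C) :=
    vectorSpan_mono ℝ (Set.image_mono (by exact_mod_cast hDC))
  obtain ⟨k, hk⟩ := h.nonempty hC
  have hge : vectorSpan ℝ (a '' ↑C) ≤ vectorSpan ℝ (a '' ↑D) := by
    by_contra hcon
    rw [vectorSpan_eq_span_vsub_set_right ℝ (Set.mem_image_of_mem a (by exact_mod_cast hDC hk)),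
      Submodule.span_le] at hcon
    rw [Set.not_subset] at hcon
    obtain ⟨_, ⟨_, ⟨i, hi, rfl⟩, rfl⟩, hnot⟩ := hcon
    obtain ⟨f, hf, hker⟩ := Submodule.exists_le_ker_of_notMem hnot
    apply hf
    have := h (f.toAffineMap - AffineMap.const ℝ _ (f (a k))) (fun j hj => by
      have : a j -ᵥ a k ∈ vectorSpan ℝ (a '' ↑D) :=
        vsub_mem_vectorSpan ℝ (Set.mem_image_of_mem a hj) (Set.mem_image_of_mem a hk)
      have := hker this
      simpa using this) i hi
    simpa using this
  unfold convDim
  rw [le_antisymm hle hge]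

lemma fullRank_of_convDim {a : Fin m → (Fin d → ℝ)} {C D : Finset (Fin m)}
    (hDC : D ⊆ C) (hD : D.Nonempty) (h : convDim a D = convDim a C) : FullRank a C D := by
  have hle : vectorSpan ℝ (a '' ↑D) ≤ vectorSpan ℝ (a '' ↑C) :=
    vectorSpan_mono ℝ (Set.image_mono (by exact_mod_cast hDC))
  have heq : vectorSpan ℝ (a '' ↑D) = vectorSpan ℝ (a '' ↑C) :=
    Submodule.eq_of_le_of_finrank_eq hle h
  obtain ⟨k, hk⟩ := hD
  intro g hg i hi
  have h1 : a i -ᵥ a k ∈ vectorSpan ℝ (a '' ↑D) := by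
    rw [heq]
    exact vsub_mem_vectorSpan ℝ (Set.mem_image_of_mem a hi) (Set.mem_image_of_mem a (hDC hk))
  have h2 : vectorSpan ℝ (a '' ↑D) ≤ LinearMap.ker g.linear := by
    rw [vectorSpan_eq_span_vsub_set_right ℝ (Set.mem_image_of_mem a hk), Submodule.span_le]
    rintro _ ⟨_, ⟨j, hj, rfl⟩, rfl⟩
    simp only [SetLike.mem_coe, LinearMap.mem_ker]
    rw [AffineMap.linearMap_vsub, hg j hj, hg k hk]
    simp
  have h3 := h2 h1
  rw [LinearMap.mem_ker, AffineMap.linearMap_vsub, hg k hk] at h3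
  simpa using h3

lemma cells_agree {a : Fin m → (Fin d → ℝ)} {C : Finset (Fin m)} {ω : Fin m → ℝ}
    {l l' : (Fin d → ℝ) →ᵃ[ℝ] ℝ} (hl' : Feas a C ω l')
    (q : Fin d → ℝ) (hq : q ∈ convexHull ℝ (a '' ↑(tightCell a C ω l))) : l' q ≤ l q := by
  refine aff_le_on_hull a _ l' l ?_ q hq
  intro i hi
  rw [(mem_tightCell.1 hi).2]
  exact hl' i (mem_tightCell.1 hi).1

lemma cells_extreme {a : Fin m → (Fin d → ℝ)} {C : Finset (Fin m)} {ω : Fin m → ℝ}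
    {l l' : (Fin d → ℝ) →ᵃ[ℝ] ℝ} (hl : Feas a C ω l) (hl' : Feas a C ω l') :
    IsExtreme ℝ (convexHull ℝ (a '' ↑(tightCell a C ω l)))
      (convexHull ℝ (a '' ↑(tightCell a C ω l)) ∩ convexHull ℝ (a '' ↑(tightCell a C ω l'))) := by
  refine ⟨Set.inter_subset_left, ?_⟩
  rintro y hy z hz p ⟨hp, hp'⟩ ⟨s, t, hs, ht, hst, rfl⟩
  refine ⟨hy, ?_⟩
  have e1 := cells_agree hl' _ hp
  have e2 := cells_agree hl _ hp'
  have ey := cells_agree hl' y hy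
  have ez := cells_agree hl' z hz
  have v1 : l (s • y + t • z) = s * l y + t * l z := by
    simpa using Convex.combo_affine_apply (f := l) (x := y) (y := z) hst
  have v2 : l' (s • y + t • z) = s * l' y + t * l' z := by
    simpa using Convex.combo_affine_apply (f := l') (x := y) (y := z) hst
  have hey : l y - l' y = 0 := by
    have : s * (l y - l' y) + t * (l z - l' z) = 0 := by
      have : l (s • y + t • z) = l' (s • y + t • z) := le_antisymm e2 e1
      rw [v1, v2] at this
      linarith
    have k1 : 0 ≤ s * (l y - l' y) := mul_nonneg hs.le (by linarith)
    have k2 : 0 ≤ t * (l z - l' z) := mul_nonneg ht.le (by linarith)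
    have k3 : s * (l y - l' y) = 0 := by linarith
    exact (mul_eq_zero.1 k3).resolve_left hs.ne'
  have := hull_zero_face a (tightCell a C ω l) (l - l') (fun i hi => by
    have h1 := mem_tightCell.1 hi
    have := hl' i h1.1
    simp [h1.2, this]) y hy (by simpa using hey)
  refine convexHull_mono (Set.image_mono ?_) this
  rintro i ⟨hi, hi0⟩
  have h1 := mem_tightCell.1 hi
  refine mem_tightCell.2 ⟨h1.1, ?_⟩
  have : l (a i) - l' (a i) = 0 := by simpa using hi0
  linarith [h1.2]

lemma cells_marks {a : Fin m → (Fin d → ℝ)} {C : Finset (Fin m)} {ω : Fin m → ℝ}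
    {l l' : (Fin d → ℝ) →ᵃ[ℝ] ℝ} (hl : Feas a C ω l) (hl' : Feas a C ω l') {i : Fin m}
    (hi : i ∈ tightCell a C ω l) (hq : a i ∈ convexHull ℝ (a '' ↑(tightCell a C ω l'))) :
    i ∈ tightCell a C ω l' := by
  have h1 := mem_tightCell.1 hi
  refine mem_tightCell.2 ⟨h1.1, le_antisymm (hl' i h1.1) ?_⟩
  rw [← h1.2]
  exact cells_agree hl _ hq

/-- Weights for which every touching cell is affinely independent. -/
def GenericWeight (a : Fin m → (Fin d → ℝ)) (ω : Fin m → ℝ) : Prop :=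
  ∀ D : Finset (Fin m), (∃ l : (Fin d → ℝ) →ᵃ[ℝ] ℝ, ∀ i ∈ D, l (a i) = ω i) →
    AffineIndependent ℝ (fun i : ↥(↑D : Set (Fin m)) => a ↑i)

/-- The triangulation induced by a generic weight. -/
noncomputable def regTriang (a : Fin m → (Fin d → ℝ)) (C : Finset (Fin m)) (ω : Fin m → ℝ) :
    Finset (Finset (Fin m)) :=
  Finset.univ.filter (fun D => ∃ l, Feas a C ω l ∧ FullRank a C D ∧ D = tightCell a C ω l)

lemma regTriang_isTriangulation (a : Fin m → (Fin d → ℝ)) (C : Finset (Fin m)) (ω : Fin m → ℝ)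
    (hC : C.Nonempty) (hω : GenericWeight a ω) : IsTriangulation a C (regTriang a C ω) := by
  refine ⟨?_, ?_, ?_⟩
  · intro σ hσ
    obtain ⟨l, hl, hr, rfl⟩ := (Finset.mem_filter.1 hσ).2
    have hind := hω (tightCell a C ω l) ⟨l, fun i hi => (mem_tightCell.1 hi).2⟩
    refine ⟨tightCell_subset a C ω l, ?_, hind⟩
    rw [← hr.convDim_eq (tightCell_subset a C ω l)]
    obtain ⟨k, hk⟩ := hr.nonempty hC
    haveI : Nonempty ↥(↑(tightCell a C ω l) : Set (Fin m)) := ⟨⟨k, hk⟩⟩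
    have := hind.finrank_vectorSpan_add_one
    have hrange : Set.range (fun i : ↥(↑(tightCell a C ω l) : Set (Fin m)) => a ↑i)
        = a '' ↑(tightCell a C ω l) := by
      rw [Set.image_eq_range]
    rw [hrange] at this
    unfold convDim
    rw [this]
    simp
  · apply Set.Subset.antisymm
    · intro p hp
      obtain ⟨l, hl, hr, hpl⟩ := cells_cover a C ω p hp
      simp only [Set.mem_iUnion]
      exact ⟨tightCell a C ω l, Finset.mem_filter.2 ⟨Finset.mem_univ _, l, hl, hr, rfl⟩, hpl⟩
    · refine Set.iUnion₂_subset ?_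
      intro σ hσ
      obtain ⟨l, hl, hr, rfl⟩ := (Finset.mem_filter.1 hσ).2
      exact convexHull_mono (Set.image_mono (by exact_mod_cast tightCell_subset a C ω l))
  · intro σ hσ τ hτ
    obtain ⟨l, hl, hr, rfl⟩ := (Finset.mem_filter.1 hσ).2
    obtain ⟨l', hl', hr', rfl⟩ := (Finset.mem_filter.1 hτ).2
    refine ⟨cells_extreme hl hl', ?_, ?_⟩
    · rw [Set.inter_comm]
      exact cells_extreme hl' hl
    · ext i
      constructor
      · rintro ⟨h1, h2⟩
        exact ⟨cells_marks hl hl' h1 h2, subset_convexHull ℝ _ ⟨i, h1, rfl⟩⟩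
      · rintro ⟨h1, h2⟩
        exact ⟨cells_marks hl' hl h1 h2, subset_convexHull ℝ _ ⟨i, h1, rfl⟩⟩

lemma exists_dependency (a : Fin m → (Fin d → ℝ)) (D : Finset (Fin m))
    (hD : ¬ AffineIndependent ℝ (fun i : ↥(↑D : Set (Fin m)) => a ↑i)) :
    ∃ w : Fin m → ℝ, w ≠ 0 ∧ ∀ (ω : Fin m → ℝ) (l : (Fin d → ℝ) →ᵃ[ℝ] ℝ),
      (∀ i ∈ D, l (a i) = ω i) → ∑ i, w i * ω i = 0 := by
  rw [affineIndependent_iff] at hD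
  push Not at hD
  obtain ⟨s, w, hw, hwa, e, he, hne⟩ := hD
  set w' : Fin m → ℝ := fun i => if h : i ∈ (↑D : Set (Fin m)) then
    (if (⟨i, h⟩ : ↥(↑D : Set (Fin m))) ∈ s then w ⟨i, h⟩ else 0) else 0 with hw'
  have hval : ∀ x : ↥(↑D : Set (Fin m)), w' ↑x = if x ∈ s then w x else 0 := by
    intro x
    simp only [hw', dif_pos x.2]
  have hsum : ∀ f : Fin m → ℝ, ∑ i, w' i * f i = ∑ x ∈ s, w x * f ↑x := by
    intro f
    have h1 : ∑ i, w' i * f i = ∑ i ∈ D, w' i * f i := by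
      symm
      apply Finset.sum_subset (Finset.subset_univ _)
      intro i _ hi
      have : w' i = 0 := by
        simp only [hw']
        rw [dif_neg (by exact_mod_cast hi)]
      rw [this, zero_mul]
    have h2 : ∑ i ∈ D, w' i * f i = ∑ x : ↥(↑D : Set (Fin m)), w' ↑x * f ↑x :=
      (Finset.sum_coe_sort D (fun i => w' i * f i)).symm
    rw [h1, h2]
    simp only [hval, ite_mul, zero_mul]
    rw [Finset.sum_ite_mem, Finset.univ_inter]
  refine ⟨w', ?_, ?_⟩
  · intro h0
    have := congrFun h0 ↑e
    rw [hval, if_pos he] at this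
    exact hne this
  · intro ω l hl
    rw [hsum]
    have h1 : ∀ x ∈ s, w x * ω ↑x = l.linear (w x • a ↑x) + w x * l 0 := by
      intro x _
      rw [← hl _ x.2, map_smul]
      have : l (a ↑x) = l.linear (a ↑x) + l 0 := by
        have := congrFun (AffineMap.decomp l) (a ↑x)
        simpa using this
      rw [this, smul_eq_mul]
      ring
    rw [Finset.sum_congr rfl h1, Finset.sum_add_distrib, ← map_sum, hwa, ← Finset.sum_mul, hw]
    simp

lemma eventually_generic (a : Fin m → (Fin d → ℝ)) (ψ : Fin m → ℝ) :
    ∀ᶠ t in nhdsWithin (0 : ℝ) {0}ᶜ, GenericWeight a (fun i => ψ i + t ^ (i.val + 1)) := by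
  unfold GenericWeight
  rw [Filter.eventually_all]
  intro D
  by_cases hD : AffineIndependent ℝ (fun i : ↥(↑D : Set (Fin m)) => a ↑i)
  · exact Filter.Eventually.of_forall (fun t _ => hD)
  obtain ⟨w, hw, hdep⟩ := exists_dependency a D hD
  set P : Polynomial ℝ := Polynomial.C (∑ i, w i * ψ i) +
    ∑ i : Fin m, Polynomial.C (w i) * Polynomial.X ^ (i.val + 1) with hP
  have hPne : P ≠ 0 := by
    intro h0
    apply hw
    funext j
    have := congrArg (fun Q => Polynomial.coeff Q (j.val + 1)) h0
    simp only [hP, Polynomial.coeff_add, Polynomial.finsetSum_coeff, Polynomial.coeff_C_mul_X_pow,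
      Polynomial.coeff_zero, Polynomial.coeff_C] at this
    simpa [Fin.val_inj] using this
  have hroots : {t | P.IsRoot t}.Finite := Polynomial.finite_setOf_isRoot hPne
  have hev : ∀ᶠ t in nhdsWithin (0 : ℝ) {0}ᶜ, ¬ P.IsRoot t := by
    have h1 : ({t | P.IsRoot t} \ {0})ᶜ ∈ nhds (0 : ℝ) :=
      (hroots.subset Set.diff_subset).isClosed.isOpen_compl.mem_nhds (by simp)
    filter_upwards [nhdsWithin_le_nhds h1, self_mem_nhdsWithin] with t ht ht0 hr
    exact ht ⟨hr, ht0⟩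
  filter_upwards [hev] with t ht
  rintro ⟨l, hl⟩
  exfalso
  apply ht
  have := hdep _ l hl
  rw [Polynomial.IsRoot, hP]
  simp only [Polynomial.eval_add, Polynomial.eval_C, Polynomial.eval_finsetSum,
    Polynomial.eval_mul, Polynomial.eval_pow, Polynomial.eval_X]
  rw [← this, ← Finset.sum_add_distrib]
  exact Finset.sum_congr rfl (fun i _ => by ring)

lemma exists_triangulation (a : Fin m → (Fin d → ℝ)) (C : Finset (Fin m)) :
    ∃ T, IsTriangulation a C T := by
  rcases C.eq_empty_or_nonempty with rfl | hC
  · exact ⟨∅, by simp, by simp, by simp⟩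
  obtain ⟨t, ht⟩ := (eventually_generic a 0).exists
  exact ⟨_, regTriang_isTriangulation a C _ hC ht⟩

lemma secondaryPolytope_nonempty (a : Fin m → (Fin d → ℝ)) (C : Finset (Fin m)) :
    (secondaryPolytope a C).Nonempty := by
  obtain ⟨T, hT⟩ := exists_triangulation a C
  exact ⟨_, subset_convexHull ℝ _ ⟨T, hT, rfl⟩⟩

end Regular

section Measure

open MeasureTheory

variable {d m : ℕ}

lemma interior_nonempty_of_volume {K : Set (Fin d → ℝ)} (hK : Convex ℝ K)
    (hv : volume K ≠ 0) : (interior K).Nonempty := by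
  by_contra h
  rw [Set.not_nonempty_iff_eq_empty] at h
  apply hv
  have hf := hK.addHaar_frontier volume
  refine measure_mono_null ?_ hf
  rw [frontier, h, Set.sdiff_empty]
  exact subset_closure

lemma aff_eq_of_interior {K : Set (Fin d → ℝ)} (hK : (interior K).Nonempty)
    (f g : (Fin d → ℝ) →ᵃ[ℝ] ℝ) (h : ∀ x ∈ interior K, f x = g x) : f = g :=
  AffineMap.ext_on (isOpen_interior.affineSpan_eq_top hK) h

lemma exists_affineBasis (a : Fin m → (Fin d → ℝ)) (σ : Finset (Fin m))
    (hc : σ.card = d + 1)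
    (hind : AffineIndependent ℝ (fun i : ↥(↑σ : Set (Fin m)) => a ↑i)) :
    ∃ b : AffineBasis ↥(↑σ : Set (Fin m)) ℝ (Fin d → ℝ), ∀ i, b i = a ↑i := by
  have htop := hind.affineSpan_eq_top_iff_card_eq_finrank_add_one.2 (by simp [hc])
  exact ⟨⟨_, hind, htop⟩, fun i => rfl⟩

lemma affineBasis_swap_integral {ι : Type} [Fintype ι] (b : AffineBasis ι ℝ (Fin d → ℝ))
    (i j : ι) (hij : i ≠ j) :
    ∫ x in {x | ∀ k, 0 ≤ b.coord k x}, b.coord i x = ∫ x in {x | ∀ k, 0 ≤ b.coord k x}, b.coord j x := by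
  set v := b j - b i with hv
  set u : (Fin d → ℝ) →ᵃ[ℝ] ℝ := b.coord i - b.coord j with hu
  set L : (Fin d → ℝ) →ₗ[ℝ] (Fin d → ℝ) := LinearMap.id + u.linear.smulRight v with hL
  set f : (Fin d → ℝ) → (Fin d → ℝ) := fun x => x + u x • v with hf
  have huv : u.linear v = -2 := by
    have : u.linear (b j -ᵥ b i) = u (b j) - u (b i) := by
      rw [AffineMap.linearMap_vsub]; rfl
    rw [vsub_eq_sub] at this
    rw [hv, this]
    simp [hu, b.coord_apply, hij, hij.symm]
    norm_num
  have hudec : ∀ x, u x = u.linear x + u 0 := by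
    intro x
    have := congrFun (AffineMap.decomp u) x
    simpa using this
  have hfL : ∀ x, f x = L x + u 0 • v := by
    intro x
    simp only [hf, hL, LinearMap.add_apply, LinearMap.id_apply, LinearMap.smulRight_apply]
    rw [hudec x, add_smul, add_assoc]
  have hLL : L ∘ₗ L = LinearMap.id := by
    ext1 x
    ext k
    simp [hL, huv]
    ring
  have hdet : |LinearMap.det L| = 1 := by
    have h1 : LinearMap.det L * LinearMap.det L = 1 := by
      rw [← LinearMap.det_comp, hLL, LinearMap.det_id]
    have h2 : |LinearMap.det L| * |LinearMap.det L| = 1 := by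
      rw [← abs_mul, h1, abs_one]
    nlinarith [abs_nonneg (LinearMap.det L)]
  have hdet0 : LinearMap.det L ≠ 0 := by
    intro h0
    rw [h0] at hdet
    simp at hdet
  have hLc : Continuous L := L.continuous_of_finiteDimensional
  have hcoord : ∀ k x, b.coord k (f x) = b.coord (Equiv.swap i j k) x := by
    intro k x
    have h1 : b.coord k (f x) = b.coord k x + u x * ((b.coord k).linear v) := by
      have : f x = (u x • v) +ᵥ x := by simp [hf, add_comm]
      rw [this, AffineMap.map_vadd]
      simp [add_comm]
    have h2 : (b.coord k).linear v = b.coord k (b j) - b.coord k (b i) := by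
      have := AffineMap.linearMap_vsub (b.coord k) (b j) (b i)
      simpa [hv] using this
    rw [h1, h2]
    have hux : u x = b.coord i x - b.coord j x := by simp [hu]
    rw [hux]
    by_cases hki : k = i
    · subst hki
      simp [b.coord_apply, hij]
    · by_cases hkj : k = j
      · subst hkj
        simp [b.coord_apply, hki]
      · rw [Equiv.swap_apply_of_ne_of_ne hki hkj]
        simp [b.coord_apply, hki, hkj]
  have hff : ∀ x, f (f x) = x := by
    intro x
    apply b.ext_elem
    intro k
    rw [hcoord, hcoord, Equiv.swap_apply_self]
  have hfc : Continuous f := by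
    have : f = fun x => L x + u 0 • v := funext hfL
    rw [this]
    fun_prop
  have hmp : MeasurePreserving f volume volume := by
    have h1 : MeasurePreserving L volume volume := by
      refine ⟨hLc.measurable, ?_⟩
      rw [Measure.map_linearMap_addHaar_eq_smul_addHaar volume hdet0, abs_inv, hdet]
      simp
    have h2 : MeasurePreserving (fun x : Fin d → ℝ => x + u 0 • v) volume volume :=
      measurePreserving_add_right volume (u 0 • v)
    have : f = (fun x : Fin d → ℝ => x + u 0 • v) ∘ L := funext hfL
    rw [this]
    exact h2.comp h1
  have hemb : MeasurableEmbedding f :=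
    (Homeomorph.mk ⟨f, f, hff, hff⟩ hfc hfc).measurableEmbedding
  have hpre : f ⁻¹' {x | ∀ k, 0 ≤ b.coord k x} = {x | ∀ k, 0 ≤ b.coord k x} := by
    ext x
    simp only [Set.mem_preimage, Set.mem_ofPred_eq, hcoord]
    constructor
    · intro h k
      have := h (Equiv.swap i j k)
      rwa [Equiv.swap_apply_self] at this
    · intro h k
      exact h _
  have := hmp.setIntegral_preimage_emb hemb (fun x => b.coord j x) {x | ∀ k, 0 ≤ b.coord k x}
  rw [hpre] at this
  rw [← this]
  simp [hcoord]

lemma hull_isCompact (a : Fin m → (Fin d → ℝ)) (σ : Finset (Fin m)) :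
    IsCompact (convexHull ℝ (a '' ↑σ)) :=
  ((Finset.finite_toSet _).image a).isCompact_convexHull ℝ

lemma aff_integrableOn {K : Set (Fin d → ℝ)} (hK : IsCompact K) (f : (Fin d → ℝ) →ᵃ[ℝ] ℝ) :
    IntegrableOn f K volume :=
  (AffineMap.continuous_of_finiteDimensional f).continuousOn.integrableOn_compact hK

lemma simplex_integral (a : Fin m → (Fin d → ℝ)) (σ : Finset (Fin m))
    (hc : σ.card = d + 1)
    (hind : AffineIndependent ℝ (fun i : ↥(↑σ : Set (Fin m)) => a ↑i))
    (l : (Fin d → ℝ) →ᵃ[ℝ] ℝ) :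
    (d + 1 : ℝ) * ∫ x in convexHull ℝ (a '' ↑σ), l x =
      (volume (convexHull ℝ (a '' ↑σ))).toReal * ∑ i ∈ σ, l (a i) := by
  obtain ⟨b, hb⟩ := exists_affineBasis a σ hc hind
  have hrange : a '' ↑σ = Set.range b := by
    rw [Set.image_eq_range]
    congr 1
    funext i
    exact (hb i).symm
  have hcomp : IsCompact (convexHull ℝ (a '' ↑σ)) := hull_isCompact a σ
  set K := convexHull ℝ (a '' ↑σ) with hK
  have hKeq : K = {x | ∀ k, 0 ≤ b.coord k x} := by
    rw [hK, hrange, b.convexHull_eq_nonneg_coord]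
  have hsame : ∀ i j, ∫ x in K, b.coord i x = ∫ x in K, b.coord j x := by
    intro i j
    by_cases hij : i = j
    · rw [hij]
    · rw [hKeq]
      exact affineBasis_swap_integral b i j hij
  have hcard : (Fintype.card ↥(↑σ : Set (Fin m)) : ℝ) = d + 1 := by
    have : Fintype.card ↥(↑σ : Set (Fin m)) = d + 1 := by simp [hc]
    rw [this]
    push_cast
    ring
  have hone : ∀ i, (d + 1 : ℝ) * ∫ x in K, b.coord i x = (volume K).toReal := by
    intro i
    have h1 : ∑ j, ∫ x in K, b.coord j x = (volume K).toReal := by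
      rw [← integral_finsetSum _ (fun j _ => aff_integrableOn hcomp (b.coord j))]
      simp only [b.sum_coord_apply_eq_one]
      simp [Measure.real]
    rw [← h1, Finset.sum_congr rfl (fun j _ => hsame j i), Finset.sum_const, nsmul_eq_mul,
      Finset.card_univ, hcard]
  have hl : ∀ x, l x = ∑ i : ↥(↑σ : Set (Fin m)), l (a ↑i) * b.coord i x := by
    intro x
    have h1 := b.affineCombination_coord_eq_self x
    conv_lhs => rw [← h1]
    rw [Finset.map_affineCombination _ _ _ (b.sum_coord_apply_eq_one x),
      Finset.affineCombination_eq_linear_combination _ _ _ (b.sum_coord_apply_eq_one x)]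
    simp [hb, mul_comm]
  have hlint : ∫ x in K, l x = ∑ i : ↥(↑σ : Set (Fin m)), l (a ↑i) * ∫ x in K, b.coord i x := by
    conv_lhs => rw [funext hl]
    rw [integral_finsetSum _ (fun j _ => (aff_integrableOn hcomp (b.coord j)).const_mul _)]
    simp only [integral_const_mul]
  rw [hlint, Finset.mul_sum]
  have h3 : ∀ i : ↥(↑σ : Set (Fin m)), (d + 1 : ℝ) * (l (a ↑i) * ∫ x in K, b.coord i x) =
      (volume K).toReal * l (a ↑i) := by
    intro i
    rw [← hone i]
    ring
  simp only [h3]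
  rw [← Finset.mul_sum]
  congr 1
  exact Finset.sum_coe_sort σ (fun i => l (a i))

lemma simplex_interp (a : Fin m → (Fin d → ℝ)) (σ : Finset (Fin m))
    (hc : σ.card = d + 1)
    (hind : AffineIndependent ℝ (fun i : ↥(↑σ : Set (Fin m)) => a ↑i)) (ω : Fin m → ℝ) :
    ∃ l : (Fin d → ℝ) →ᵃ[ℝ] ℝ, ∀ i ∈ σ, l (a i) = ω i := by
  obtain ⟨b, hb⟩ := exists_affineBasis a σ hc hind
  refine ⟨∑ i : ↥(↑σ : Set (Fin m)), ω ↑i • b.coord i, ?_⟩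
  intro i hi
  have h1 : a i = b ⟨i, hi⟩ := (hb ⟨i, hi⟩).symm
  have h2 : ∀ (s : Finset ↥(↑σ : Set (Fin m))) x,
      (∑ i ∈ s, ω ↑i • b.coord i) x = ∑ i ∈ s, ω ↑i * b.coord i x := by
    intro s x
    induction s using Finset.induction_on with
    | empty => simp
    | insert k s hk ih => rw [Finset.sum_insert hk, Finset.sum_insert hk, ← ih]; simp
  rw [h2, h1]
  simp [b.coord_apply]

lemma simplex_interior (a : Fin m → (Fin d → ℝ)) (σ : Finset (Fin m))
    (hc : σ.card = d + 1)
    (hind : AffineIndependent ℝ (fun i : ↥(↑σ : Set (Fin m)) => a ↑i)) :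
    (interior (convexHull ℝ (a '' ↑σ))).Nonempty := by
  rw [interior_convexHull_nonempty_iff_affineSpan_eq_top, Set.image_eq_range]
  exact hind.affineSpan_eq_top_iff_card_eq_finrank_add_one.2 (by simp [hc])

/-- A finite family of compact convex sets with null overlaps and union `X`. -/
structure Tiling {ι : Type} (X : Set (Fin d → ℝ)) (s : Finset ι) (K : ι → Set (Fin d → ℝ)) :
    Prop where
  compact : ∀ i ∈ s, IsCompact (K i)
  convex : ∀ i ∈ s, Convex ℝ (K i)
  overlap : ∀ i ∈ s, ∀ j ∈ s, i ≠ j → volume (K i ∩ K j) = 0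
  cover : X = ⋃ i ∈ s, K i

lemma tile_integral {ι : Type} (s : Finset ι) (K : ι → Set (Fin d → ℝ))
    (hK : ∀ i ∈ s, IsCompact (K i))
    (hd : ∀ i ∈ s, ∀ j ∈ s, i ≠ j → volume (K i ∩ K j) = 0) (f : (Fin d → ℝ) →ᵃ[ℝ] ℝ) :
    ∫ x in ⋃ i ∈ s, K i, f x = ∑ i ∈ s, ∫ x in K i, f x := by
  induction s using Finset.induction_on with
  | empty => simp
  | insert k s hk ih =>
    have hKs : ∀ i ∈ s, IsCompact (K i) := fun i hi => hK i (Finset.mem_insert_of_mem hi)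
    rw [Finset.set_biUnion_insert, Finset.sum_insert hk, ← ih hKs (fun i hi j hj =>
      hd i (Finset.mem_insert_of_mem hi) j (Finset.mem_insert_of_mem hj))]
    have hcU : IsCompact (⋃ i ∈ s, K i) := s.isCompact_biUnion hKs
    refine setIntegral_union₀ ?_ hcU.measurableSet.nullMeasurableSet
      (aff_integrableOn (hK k (Finset.mem_insert_self _ _)) f) (aff_integrableOn hcU f)
    change volume _ = 0
    rw [Set.inter_iUnion₂]
    refine (measure_biUnion_null_iff s.countable_toSet).2 ?_
    intro i hi
    refine hd k (Finset.mem_insert_self _ _) i (Finset.mem_insert_of_mem hi) ?_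
    rintro rfl
    exact hk hi

lemma Tiling.split {ι κ : Type} {X : Set (Fin d → ℝ)} {s : Finset ι}
    {K : ι → Set (Fin d → ℝ)} {t : Finset κ} {L : κ → Set (Fin d → ℝ)}
    (hK : Tiling X s K) (hL : Tiling X t L) (f : (Fin d → ℝ) →ᵃ[ℝ] ℝ) {i : ι} (hi : i ∈ s) :
    ∫ x in K i, f x = ∑ j ∈ t, ∫ x in K i ∩ L j, f x := by
  have hKi : K i = ⋃ j ∈ t, K i ∩ L j := by
    rw [← Set.inter_iUnion₂, ← hL.cover, eq_comm, Set.inter_eq_left, hK.cover]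
    exact Set.subset_biUnion_of_mem (u := K) (by exact_mod_cast hi)
  conv_lhs => rw [hKi]
  refine tile_integral t _ (fun j hj => (hK.compact i hi).inter (hL.compact j hj)) ?_ f
  intro j hj k hk hjk
  refine measure_mono_null ?_ (hL.overlap j hj k hk hjk)
  exact Set.inter_subset_inter Set.inter_subset_right Set.inter_subset_right

lemma Tiling.diff_eq {ι κ : Type} {X : Set (Fin d → ℝ)} {s : Finset ι}
    {K : ι → Set (Fin d → ℝ)} {t : Finset κ} {L : κ → Set (Fin d → ℝ)}
    (hK : Tiling X s K) (hL : Tiling X t L) (f : ι → (Fin d → ℝ) →ᵃ[ℝ] ℝ)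
    (g : κ → (Fin d → ℝ) →ᵃ[ℝ] ℝ) :
    (∑ i ∈ s, ∫ x in K i, f i x) - (∑ j ∈ t, ∫ x in L j, g j x) =
      ∑ i ∈ s, ∑ j ∈ t, ∫ x in K i ∩ L j, (f i x - g j x) := by
  have h1 : ∑ i ∈ s, ∫ x in K i, f i x = ∑ i ∈ s, ∑ j ∈ t, ∫ x in K i ∩ L j, f i x :=
    Finset.sum_congr rfl (fun i hi => hK.split hL (f i) hi)
  have h2 : ∑ j ∈ t, ∫ x in L j, g j x = ∑ i ∈ s, ∑ j ∈ t, ∫ x in K i ∩ L j, g j x := by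
    rw [Finset.sum_comm]
    refine Finset.sum_congr rfl (fun j hj => ?_)
    rw [hL.split hK (g j) hj]
    refine Finset.sum_congr rfl (fun i hi => ?_)
    rw [Set.inter_comm]
  rw [h1, h2, ← Finset.sum_sub_distrib]
  refine Finset.sum_congr rfl (fun i hi => ?_)
  rw [← Finset.sum_sub_distrib]
  refine Finset.sum_congr rfl (fun j hj => ?_)
  have hc := (hK.compact i hi).inter (hL.compact j hj)
  rw [integral_sub (aff_integrableOn hc (f i)) (aff_integrableOn hc (g j))]

lemma Tiling.compare {ι κ : Type} {X : Set (Fin d → ℝ)} {s : Finset ι}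
    {K : ι → Set (Fin d → ℝ)} {t : Finset κ} {L : κ → Set (Fin d → ℝ)}
    (hK : Tiling X s K) (hL : Tiling X t L) (f : ι → (Fin d → ℝ) →ᵃ[ℝ] ℝ)
    (g : κ → (Fin d → ℝ) →ᵃ[ℝ] ℝ)
    (hfg : ∀ i ∈ s, ∀ j ∈ t, ∀ x ∈ K i ∩ L j, g j x ≤ f i x) :
    (∑ j ∈ t, ∫ x in L j, g j x) ≤ (∑ i ∈ s, ∫ x in K i, f i x) := by
  rw [← sub_nonneg, hK.diff_eq hL]
  refine Finset.sum_nonneg (fun i hi => Finset.sum_nonneg (fun j hj => ?_))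
  refine setIntegral_nonneg ((hK.compact i hi).inter (hL.compact j hj)).measurableSet ?_
  intro x hx
  linarith [hfg i hi j hj x hx]

lemma Tiling.compare_eq {ι κ : Type} {X : Set (Fin d → ℝ)} {s : Finset ι}
    {K : ι → Set (Fin d → ℝ)} {t : Finset κ} {L : κ → Set (Fin d → ℝ)}
    (hK : Tiling X s K) (hL : Tiling X t L) (f : ι → (Fin d → ℝ) →ᵃ[ℝ] ℝ)
    (g : κ → (Fin d → ℝ) →ᵃ[ℝ] ℝ)
    (hfg : ∀ i ∈ s, ∀ j ∈ t, ∀ x ∈ K i ∩ L j, g j x ≤ f i x)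
    (heq : (∑ i ∈ s, ∫ x in K i, f i x) ≤ (∑ j ∈ t, ∫ x in L j, g j x))
    {i : ι} (hi : i ∈ s) {j : κ} (hj : j ∈ t) (hv : volume (K i ∩ L j) ≠ 0) : f i = g j := by
  have hnn : ∀ i ∈ s, ∀ j ∈ t, 0 ≤ ∫ x in K i ∩ L j, (f i x - g j x) := by
    intro i hi j hj
    refine setIntegral_nonneg ((hK.compact i hi).inter (hL.compact j hj)).measurableSet ?_
    intro x hx
    linarith [hfg i hi j hj x hx]
  have hle : ∑ i ∈ s, ∑ j ∈ t, ∫ x in K i ∩ L j, (f i x - g j x) ≤ 0 := by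
    rw [← hK.diff_eq hL]
    linarith
  have hz1 := (Finset.sum_eq_zero_iff_of_nonneg
    (fun i hi => Finset.sum_nonneg (hnn i hi))).1
    (le_antisymm hle (Finset.sum_nonneg (fun i hi => Finset.sum_nonneg (hnn i hi)))) i hi
  have hz := (Finset.sum_eq_zero_iff_of_nonneg (hnn i hi)).1 hz1 j hj
  have hcomp := (hK.compact i hi).inter (hL.compact j hj)
  have hconv := (hK.convex i hi).inter (hL.convex j hj)
  have hinter := interior_nonempty_of_volume hconv hv
  have hcf : Continuous (f i) := AffineMap.continuous_of_finiteDimensional _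
  have hcg : Continuous (g j) := AffineMap.continuous_of_finiteDimensional _
  rw [setIntegral_eq_zero_iff_of_nonneg_ae] at hz
  · refine aff_eq_of_interior hinter _ _ ?_
    have h1 : (fun x => f i x - g j x) =ᵐ[volume.restrict (interior (K i ∩ L j))] 0 :=
      ae_restrict_of_ae_restrict_of_subset interior_subset hz
    have h2 := Measure.eqOn_open_of_ae_eq h1 isOpen_interior
      (hcf.sub hcg).continuousOn continuousOn_const
    intro x hx
    have := h2 hx
    simp only [Pi.zero_apply] at this
    linarith
  · refine (ae_restrict_iff' hcomp.measurableSet).2 (Filter.Eventually.of_forall ?_)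
    intro x hx
    simp only [Pi.zero_apply]
    linarith [hfg i hi j hj x hx]
  · exact (aff_integrableOn hcomp (f i)).sub (aff_integrableOn hcomp (g j))

lemma extreme_of_interior {K F : Set (Fin d → ℝ)} (hF : IsExtreme ℝ K F)
    (h : (interior F).Nonempty) : K ⊆ F := by
  obtain ⟨p, hp⟩ := h
  intro y hy
  have hc : Continuous (fun t : ℝ => p + t • (p - y)) := by fun_prop
  have hev : ∀ᶠ t in nhds (0 : ℝ), p + t • (p - y) ∈ interior F :=
    hc.continuousAt.eventually_mem (isOpen_interior.mem_nhds (by simpa using hp))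
  have hev' : ∀ᶠ t in nhdsWithin (0 : ℝ) (Set.Ioi 0), p + t • (p - y) ∈ interior F :=
    nhdsWithin_le_nhds hev
  obtain ⟨t, ht, htp⟩ := (hev'.and self_mem_nhdsWithin).exists
  have htp' : (0 : ℝ) < t := htp
  refine hF.2 hy (hF.1 (interior_subset ht)) (interior_subset hp) ?_
  refine ⟨t / (1 + t), 1 / (1 + t), by positivity, by positivity, by field_simp; ring, ?_⟩
  ext k
  simp
  field_simp
  ring

lemma triangulation_overlap {a : Fin m → (Fin d → ℝ)} {C : Finset (Fin m)}
    {T : Finset (Finset (Fin m))} (hT : IsTriangulation a C T)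
    {σ τ : Finset (Fin m)} (hσ : σ ∈ T) (hτ : τ ∈ T) (hne : σ ≠ τ) :
    volume (convexHull ℝ (a '' ↑σ) ∩ convexHull ℝ (a '' ↑τ)) = 0 := by
  by_contra hv
  have hinter := interior_nonempty_of_volume
    ((convex_convexHull ℝ (a '' ↑σ)).inter (convex_convexHull ℝ (a '' ↑τ))) hv
  obtain ⟨h1, h2, h3⟩ := hT.2.2 σ hσ τ hτ
  have k1 := extreme_of_interior h1 hinter
  have k2 := extreme_of_interior h2 hinter
  apply hne
  ext i
  constructor
  · intro hi
    have : i ∈ (↑σ : Set (Fin m)) ∩ {i | a i ∈ convexHull ℝ (a '' ↑τ)} :=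
      ⟨hi, (k1 (subset_convexHull ℝ _ ⟨i, hi, rfl⟩)).2⟩
    rw [h3] at this
    exact this.1
  · intro hi
    have : i ∈ (↑τ : Set (Fin m)) ∩ {i | a i ∈ convexHull ℝ (a '' ↑σ)} :=
      ⟨hi, (k2 (subset_convexHull ℝ _ ⟨i, hi, rfl⟩)).1⟩
    rw [← h3] at this
    exact this.1

lemma triangulation_tiling {a : Fin m → (Fin d → ℝ)} {C : Finset (Fin m)}
    {T : Finset (Finset (Fin m))} (hT : IsTriangulation a C T) :
    Tiling (convexHull ℝ (a '' ↑C)) T (fun σ => convexHull ℝ (a '' ↑σ)) :=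
  ⟨fun _ _ => hull_isCompact a _, fun _ _ => convex_convexHull ℝ _,
    fun _ hσ _ hτ hne => triangulation_overlap hT hσ hτ hne, hT.2.1⟩

/-- Pairing of a weight with a GKZ-vector as an integral of interpolations. -/
lemma gkz_pairing (a : Fin m → (Fin d → ℝ)) (T : Finset (Finset (Fin m)))
    (hT : ∀ σ ∈ T, σ.card = d + 1 ∧ AffineIndependent ℝ (fun i : ↥(↑σ : Set (Fin m)) => a ↑i))
    (ω : Fin m → ℝ) (l : Finset (Fin m) → (Fin d → ℝ) →ᵃ[ℝ] ℝ)
    (hl : ∀ σ ∈ T, ∀ i ∈ σ, l σ (a i) = ω i) :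
    ∑ i, ω i * gkzVector a T i =
      (d + 1 : ℝ) * ∑ σ ∈ T, ∫ x in convexHull ℝ (a '' ↑σ), l σ x := by
  unfold gkzVector
  simp only [Finset.mul_sum]
  rw [Finset.sum_comm]
  refine Finset.sum_congr rfl (fun σ hσ => ?_)
  rw [simplex_integral a σ (hT σ hσ).1 (hT σ hσ).2, Finset.mul_sum]
  simp only [mul_ite, mul_zero]
  rw [Finset.sum_ite_mem, Finset.univ_inter]
  refine Finset.sum_congr rfl (fun i hi => ?_)
  rw [hl σ hσ i hi, mul_comm]

end Measure

section Cells

open MeasureTheory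

variable {d m : ℕ}

lemma aff_coord (l : (Fin d → ℝ) →ᵃ[ℝ] ℝ) (q : Fin d → ℝ) :
    l q = l 0 + ∑ t, q t * l.linear (Pi.single t 1) := by
  have h1 : l q = l.linear q + l 0 := by
    have := congrFun (AffineMap.decomp l) q
    simpa using this
  have h2 : l.linear q = ∑ t, q t * l.linear (Pi.single t 1) := by
    conv_lhs => rw [pi_eq_sum_univ' q]
    rw [map_sum]
    refine Finset.sum_congr rfl (fun t _ => ?_)
    rw [map_smul, smul_eq_mul]
  rw [h1, h2, add_comm]

lemma isMaxCell_iff (hm : (Finset.univ : Finset (Fin m)).Nonempty) (a : Fin m → (Fin d → ℝ))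
    (ω : Fin m → ℝ) (C : Finset (Fin m)) :
    IsMaxCell a ω C ↔ ∃ l, Feas a Finset.univ ω l ∧ FullRank a Finset.univ C ∧
      C = tightCell a Finset.univ ω l := by
  constructor
  · rintro ⟨⟨x, hx⟩, hdim⟩
    obtain ⟨k, -, hk⟩ := Finset.exists_min_image Finset.univ
      (fun i => ω i + ∑ t, a i t * x t) hm
    set c := ω k + ∑ t, a k t * x t with hc
    set φ : (Fin d → ℝ) →ₗ[ℝ] ℝ := ∑ t, x t • LinearMap.proj t with hφ
    set l : (Fin d → ℝ) →ᵃ[ℝ] ℝ := AffineMap.const ℝ _ c - φ.toAffineMap with hl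
    have hlv : ∀ q, l q = c - ∑ t, q t * x t := by
      intro q
      simp [hl, hφ, mul_comm]
    have hmem : ∀ i, i ∈ C ↔ ∀ j, ω i + ∑ t, a i t * x t ≤ ω j + ∑ t, a j t * x t := by
      intro i
      have := Set.ext_iff.1 hx i
      simpa using this
    have hkC : k ∈ C := (hmem k).2 (fun j => hk j (Finset.mem_univ _))
    refine ⟨l, ?_, fullRank_of_convDim (Finset.subset_univ _) ⟨k, hkC⟩ hdim, ?_⟩
    · intro i _
      have := hk i (Finset.mem_univ _)
      rw [hlv]
      linarith
    · ext i
      rw [hmem, mem_tightCell, hlv]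
      constructor
      · intro h
        have h1 := h k
        have h2 := hk i (Finset.mem_univ _)
        exact ⟨Finset.mem_univ _, by linarith⟩
      · rintro ⟨-, h⟩ j
        have h2 := hk j (Finset.mem_univ _)
        linarith
  · rintro ⟨l, hl, hr, rfl⟩
    refine ⟨⟨fun t => - l.linear (Pi.single t 1), ?_⟩, hr.convDim_eq (Finset.subset_univ _)⟩
    have hval : ∀ i, ω i + ∑ t, a i t * (- l.linear (Pi.single t 1)) = ω i - l (a i) + l 0 := by
      intro i
      rw [aff_coord l (a i)]
      simp only [mul_neg, Finset.sum_neg_distrib]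
      ring
    obtain ⟨k, hk⟩ := hr.nonempty hm
    have hk' := (mem_tightCell.1 hk).2
    ext i
    simp only [hval, Finset.mem_coe, Set.mem_ofPred_eq, mem_tightCell, Finset.mem_univ, true_and]
    constructor
    · intro h j
      have := hl j (Finset.mem_univ _)
      linarith
    · intro h
      have h1 := h k
      have h2 := hl i (Finset.mem_univ _)
      linarith

/-- The maximal cells as a finset. -/
noncomputable def maxCells (a : Fin m → (Fin d → ℝ)) (ω : Fin m → ℝ) : Finset (Finset (Fin m)) :=
  Finset.univ.filter (fun C => IsMaxCell a ω C)

/-- `L` selects the supporting affine function of each maximal cell. -/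
def CellFun (a : Fin m → (Fin d → ℝ)) (ω : Fin m → ℝ)
    (L : Finset (Fin m) → (Fin d → ℝ) →ᵃ[ℝ] ℝ) : Prop :=
  ∀ C ∈ maxCells a ω, Feas a Finset.univ ω (L C) ∧ FullRank a Finset.univ C ∧
    C = tightCell a Finset.univ ω (L C)

lemma exists_cellFun (hm : (Finset.univ : Finset (Fin m)).Nonempty) (a : Fin m → (Fin d → ℝ))
    (ω : Fin m → ℝ) : ∃ L, CellFun a ω L := by
  have : ∀ C : Finset (Fin m), ∃ l : (Fin d → ℝ) →ᵃ[ℝ] ℝ, C ∈ maxCells a ω →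
      Feas a Finset.univ ω l ∧ FullRank a Finset.univ C ∧ C = tightCell a Finset.univ ω l := by
    intro C
    by_cases hC : C ∈ maxCells a ω
    · obtain ⟨l, hl⟩ := (isMaxCell_iff hm a ω C).1 (Finset.mem_filter.1 hC).2
      exact ⟨l, fun _ => hl⟩
    · exact ⟨0, fun h => absurd h hC⟩
  choose L hL using this
  exact ⟨L, hL⟩

lemma CellFun.mem_iff {a : Fin m → (Fin d → ℝ)} {ω : Fin m → ℝ}
    {L : Finset (Fin m) → (Fin d → ℝ) →ᵃ[ℝ] ℝ} (hL : CellFun a ω L) {C : Finset (Fin m)}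
    (hC : C ∈ maxCells a ω) (i : Fin m) : i ∈ C ↔ L C (a i) = ω i := by
  obtain ⟨-, -, h⟩ := hL C hC
  conv_lhs => rw [h, mem_tightCell]
  simp

lemma CellFun.inj {a : Fin m → (Fin d → ℝ)} {ω : Fin m → ℝ}
    {L : Finset (Fin m) → (Fin d → ℝ) →ᵃ[ℝ] ℝ} (hL : CellFun a ω L) {C C' : Finset (Fin m)}
    (hC : C ∈ maxCells a ω) (hC' : C' ∈ maxCells a ω) (h : L C = L C') : C = C' := by
  ext i
  rw [hL.mem_iff hC, hL.mem_iff hC', h]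

lemma cells_tiling (hm : (Finset.univ : Finset (Fin m)).Nonempty) {a : Fin m → (Fin d → ℝ)}
    {ω : Fin m → ℝ} {L : Finset (Fin m) → (Fin d → ℝ) →ᵃ[ℝ] ℝ} (hL : CellFun a ω L) :
    Tiling (convexHull ℝ (a '' ↑(Finset.univ : Finset (Fin m)))) (maxCells a ω)
      (fun C => convexHull ℝ (a '' ↑C)) := by
  refine ⟨fun _ _ => hull_isCompact a _, fun _ _ => convex_convexHull ℝ _, ?_, ?_⟩
  · intro C hC C' hC' hne
    by_contra hv
    have hinter := interior_nonempty_of_volume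
      ((convex_convexHull ℝ (a '' ↑C)).inter (convex_convexHull ℝ (a '' ↑C'))) hv
    apply hne
    apply hL.inj hC hC'
    refine aff_eq_of_interior hinter _ _ ?_
    intro x hx
    obtain ⟨hx1, hx2⟩ := interior_subset hx
    obtain ⟨f1, -, e1⟩ := hL C hC
    obtain ⟨f2, -, e2⟩ := hL C' hC'
    refine le_antisymm ?_ ?_
    · refine aff_le_on_hull a C' _ _ ?_ x hx2
      intro i hi
      rw [(hL.mem_iff hC' i).1 hi]
      exact f1 i (Finset.mem_univ _)
    · refine aff_le_on_hull a C _ _ ?_ x hx1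
      intro i hi
      rw [(hL.mem_iff hC i).1 hi]
      exact f2 i (Finset.mem_univ _)
  · apply Set.Subset.antisymm
    · intro p hp
      obtain ⟨l, hl, hr, hpl⟩ := cells_cover a Finset.univ ω p hp
      simp only [Set.mem_iUnion]
      exact ⟨_, Finset.mem_filter.2 ⟨Finset.mem_univ _,
        (isMaxCell_iff hm a ω _).2 ⟨l, hl, hr, rfl⟩⟩, hpl⟩
    · refine Set.iUnion₂_subset ?_
      intro C _
      exact convexHull_mono (Set.image_mono (by simp))

lemma maxCells_convDim {a : Fin m → (Fin d → ℝ)} {ω : Fin m → ℝ}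
    (hdim : convDim a Finset.univ = d) {C : Finset (Fin m)} (hC : C ∈ maxCells a ω) :
    convDim a C = d := (Finset.mem_filter.1 hC).2.2.trans hdim

lemma triangulation_simplices {a : Fin m → (Fin d → ℝ)} {C : Finset (Fin m)}
    {T : Finset (Finset (Fin m))} (hT : IsTriangulation a C T) (hdim : convDim a C = d) :
    ∀ σ ∈ T, σ.card = d + 1 ∧ AffineIndependent ℝ (fun i : ↥(↑σ : Set (Fin m)) => a ↑i) := by
  intro σ hσ
  obtain ⟨-, h2, h3⟩ := hT.1 σ hσ
  rw [hdim] at h2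
  exact ⟨h2, h3⟩

lemma exists_interp (a : Fin m → (Fin d → ℝ)) (ω : Fin m → ℝ) :
    ∃ l : Finset (Fin m) → (Fin d → ℝ) →ᵃ[ℝ] ℝ, ∀ σ : Finset (Fin m),
      (σ.card = d + 1 ∧ AffineIndependent ℝ (fun i : ↥(↑σ : Set (Fin m)) => a ↑i)) →
      ∀ i ∈ σ, l σ (a i) = ω i := by
  have : ∀ σ : Finset (Fin m), ∃ l : (Fin d → ℝ) →ᵃ[ℝ] ℝ,
      (σ.card = d + 1 ∧ AffineIndependent ℝ (fun i : ↥(↑σ : Set (Fin m)) => a ↑i)) →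
      ∀ i ∈ σ, l (a i) = ω i := by
    intro σ
    by_cases h : σ.card = d + 1 ∧ AffineIndependent ℝ (fun i : ↥(↑σ : Set (Fin m)) => a ↑i)
    · obtain ⟨l, hl⟩ := simplex_interp a σ h.1 h.2 ω
      exact ⟨l, fun _ => hl⟩
    · exact ⟨0, fun h' => absurd h' h⟩
  choose l hl using this
  exact ⟨l, hl⟩

/-- The minimal value of the weight `ω` on the secondary polytope. -/
noncomputable def minValue (a : Fin m → (Fin d → ℝ)) (ω : Fin m → ℝ)
    (L : Finset (Fin m) → (Fin d → ℝ) →ᵃ[ℝ] ℝ) : ℝ :=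
  (d + 1 : ℝ) * ∑ C ∈ maxCells a ω, ∫ x in convexHull ℝ (a '' ↑C), L C x

lemma lower_bound (hm : (Finset.univ : Finset (Fin m)).Nonempty) {a : Fin m → (Fin d → ℝ)}
    {ω : Fin m → ℝ} {L : Finset (Fin m) → (Fin d → ℝ) →ᵃ[ℝ] ℝ} (hL : CellFun a ω L)
    (hdim : convDim a Finset.univ = d) {T : Finset (Finset (Fin m))}
    (hT : IsTriangulation a Finset.univ T) :
    minValue a ω L ≤ ∑ i, ω i * gkzVector a T i ∧
    (∑ i, ω i * gkzVector a T i ≤ minValue a ω L → ∀ σ ∈ T, ∀ C ∈ maxCells a ω,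
      volume (convexHull ℝ (a '' ↑σ) ∩ convexHull ℝ (a '' ↑C)) ≠ 0 → σ ⊆ C) := by
  have hs := triangulation_simplices hT hdim
  obtain ⟨l, hl⟩ := exists_interp a ω
  have hl' : ∀ σ ∈ T, ∀ i ∈ σ, l σ (a i) = ω i := fun σ hσ => hl σ (hs σ hσ)
  have hle : ∀ σ ∈ T, ∀ C ∈ maxCells a ω,
      ∀ x ∈ convexHull ℝ (a '' ↑σ) ∩ convexHull ℝ (a '' ↑C), L C x ≤ l σ x := by
    intro σ hσ C hC x hx
    refine aff_le_on_hull a σ _ _ ?_ x hx.1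
    intro i hi
    rw [hl' σ hσ i hi]
    exact (hL C hC).1 i (Finset.mem_univ _)
  have hd : (0 : ℝ) < d + 1 := by positivity
  rw [gkz_pairing a T hs ω l hl', minValue]
  refine ⟨?_, ?_⟩
  · exact mul_le_mul_of_nonneg_left
      ((triangulation_tiling hT).compare (cells_tiling hm hL) l L hle) hd.le
  · intro h σ hσ C hC hv
    have h' := le_of_mul_le_mul_left h hd
    have heq := (triangulation_tiling hT).compare_eq (cells_tiling hm hL) l L hle h' hσ hC hv
    intro i hi
    rw [hL.mem_iff hC, ← heq, hl' σ hσ i hi]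

lemma cell_value {a : Fin m → (Fin d → ℝ)}
    {ω : Fin m → ℝ} {L : Finset (Fin m) → (Fin d → ℝ) →ᵃ[ℝ] ℝ} (hL : CellFun a ω L)
    (hdim : convDim a Finset.univ = d) {C : Finset (Fin m)} (hC : C ∈ maxCells a ω)
    {T : Finset (Finset (Fin m))} (hT : IsTriangulation a C T) :
    ∑ i, ω i * gkzVector a T i = (d + 1 : ℝ) * ∫ x in convexHull ℝ (a '' ↑C), L C x := by
  have hs := triangulation_simplices hT (maxCells_convDim hdim hC)
  rw [gkz_pairing a T hs ω (fun _ => L C)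
    (fun σ hσ i hi => (hL.mem_iff hC i).1 ((hT.1 σ hσ).1 hi)), hT.2.1]
  congr 1
  have ht := triangulation_tiling hT
  exact (tile_integral T _ ht.compact ht.overlap (L C)).symm

lemma union_lower (hm : (Finset.univ : Finset (Fin m)).Nonempty) {a : Fin m → (Fin d → ℝ)}
    {ω : Fin m → ℝ} {L : Finset (Fin m) → (Fin d → ℝ) →ᵃ[ℝ] ℝ} (hL : CellFun a ω L)
    (hdim : convDim a Finset.univ = d) (T : Finset (Fin m) → Finset (Finset (Fin m)))
    (hT : ∀ C ∈ maxCells a ω, IsTriangulation a C (T C))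
    (ψ : Fin m → ℝ) (hψ : GenericWeight a ψ) :
    ∑ i, ψ i * gkzVector a (regTriang a Finset.univ ψ) i ≤
      ∑ C ∈ maxCells a ω, ∑ i, ψ i * gkzVector a (T C) i := by
  have hR := regTriang_isTriangulation a Finset.univ ψ hm hψ
  have hRs := triangulation_simplices hR hdim
  have hTs : ∀ C ∈ maxCells a ω, _ := fun C hC =>
    triangulation_simplices (hT C hC) (maxCells_convDim hdim hC)
  obtain ⟨l, hl⟩ := exists_interp a ψ
  have hg : ∀ τ : Finset (Fin m), ∃ g : (Fin d → ℝ) →ᵃ[ℝ] ℝ, τ ∈ regTriang a Finset.univ ψ →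
      Feas a Finset.univ ψ g ∧ ∀ i ∈ τ, g (a i) = ψ i := by
    intro τ
    by_cases hτ : τ ∈ regTriang a Finset.univ ψ
    · obtain ⟨g, h1, -, h3⟩ := (Finset.mem_filter.1 hτ).2
      refine ⟨g, fun _ => ⟨h1, fun i hi => ?_⟩⟩
      rw [h3, mem_tightCell] at hi
      exact hi.2
    · exact ⟨0, fun h => absurd h hτ⟩
  choose g hg using hg
  have htile := cells_tiling hm hL
  have htiling : Tiling (convexHull ℝ (a '' ↑(Finset.univ : Finset (Fin m))))
      ((maxCells a ω).sigma T) (fun p => convexHull ℝ (a '' ↑p.2)) := by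
    refine ⟨fun _ _ => hull_isCompact a _, fun _ _ => convex_convexHull ℝ _, ?_, ?_⟩
    · rintro ⟨C, σ⟩ h1 ⟨C', σ'⟩ h2 hne
      rw [Finset.mem_sigma] at h1 h2
      by_cases hCC : C = C'
      · subst hCC
        refine triangulation_overlap (hT C h1.1) h1.2 h2.2 ?_
        rintro rfl
        exact hne rfl
      · refine measure_mono_null ?_ (htile.overlap C h1.1 C' h2.1 hCC)
        refine Set.inter_subset_inter ?_ ?_
        · exact convexHull_mono (Set.image_mono
            (by exact_mod_cast ((hT C h1.1).1 σ h1.2).1))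
        · exact convexHull_mono (Set.image_mono
            (by exact_mod_cast ((hT C' h2.1).1 σ' h2.2).1))
    · rw [htile.cover]
      ext x
      simp only [Set.mem_iUnion, Finset.mem_sigma]
      constructor
      · rintro ⟨C, hC, hx⟩
        rw [(hT C hC).2.1] at hx
        simp only [Set.mem_iUnion] at hx
        obtain ⟨σ, hσ, hx⟩ := hx
        exact ⟨⟨C, σ⟩, ⟨hC, hσ⟩, hx⟩
      · rintro ⟨⟨C, σ⟩, ⟨hC, hσ⟩, hx⟩
        refine ⟨C, hC, ?_⟩
        rw [(hT C hC).2.1]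
        simp only [Set.mem_iUnion]
        exact ⟨σ, hσ, hx⟩
  have hcmp := htiling.compare (triangulation_tiling hR) (fun p => l p.2) g (by
    rintro ⟨C, σ⟩ h1 τ hτ x hx
    rw [Finset.mem_sigma] at h1
    refine aff_le_on_hull a σ _ _ ?_ x hx.1
    intro i hi
    rw [hl σ (hTs C h1.1 σ h1.2) i hi]
    exact (hg τ hτ).1 i (Finset.mem_univ _))
  rw [Finset.sum_sigma] at hcmp
  rw [gkz_pairing a _ hRs ψ g (fun τ hτ => (hg τ hτ).2)]
  have : ∀ C ∈ maxCells a ω, ∑ i, ψ i * gkzVector a (T C) i =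
      (d + 1 : ℝ) * ∑ σ ∈ T C, ∫ x in convexHull ℝ (a '' ↑σ), l σ x := fun C hC =>
    gkz_pairing a _ (hTs C hC) ψ l (fun σ hσ => hl σ (hTs C hC σ hσ))
  rw [Finset.sum_congr rfl this, ← Finset.mul_sum]
  exact mul_le_mul_of_nonneg_left hcmp (by positivity)

lemma refine_cells (hm : (Finset.univ : Finset (Fin m)).Nonempty) {a : Fin m → (Fin d → ℝ)}
    {ω : Fin m → ℝ} {L : Finset (Fin m) → (Fin d → ℝ) →ᵃ[ℝ] ℝ} (hL : CellFun a ω L)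
    (hdim : convDim a Finset.univ = d) {T : Finset (Finset (Fin m))}
    (hT : IsTriangulation a Finset.univ T)
    (hle : ∑ i, ω i * gkzVector a T i ≤ minValue a ω L) :
    (∀ C ∈ maxCells a ω, IsTriangulation a C (T.filter (fun σ => σ ⊆ C))) ∧
    gkzVector a T = ∑ C ∈ maxCells a ω, gkzVector a (T.filter (fun σ => σ ⊆ C)) := by
  have hs := triangulation_simplices hT hdim
  have hsub := (lower_bound hm hL hdim hT).2 hle
  have htile := cells_tiling hm hL
  refine ⟨?_, ?_⟩
  · intro C hC
    refine ⟨?_, ?_, ?_⟩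
    · intro σ hσ
      rw [Finset.mem_filter] at hσ
      refine ⟨hσ.2, ?_, (hs σ hσ.1).2⟩
      rw [maxCells_convDim hdim hC]
      exact (hs σ hσ.1).1
    · apply Set.Subset.antisymm
      · set U := ⋃ σ ∈ T.filter (fun σ => σ ⊆ C), convexHull ℝ (a '' (↑σ : Set (Fin m))) with hU
        have hUc : IsCompact U := Finset.isCompact_biUnion _ (fun σ _ => hull_isCompact a σ)
        have hnull : volume (convexHull ℝ (a '' ↑C) \ U) = 0 := by
          have hincl : convexHull ℝ (a '' ↑C) \ U ⊆ ⋃ σ ∈ T.filter (fun σ => ¬ σ ⊆ C),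
              convexHull ℝ (a '' ↑σ) ∩ convexHull ℝ (a '' ↑C) := by
            rintro x ⟨hxC, hxU⟩
            have hx : x ∈ convexHull ℝ (a '' ↑(Finset.univ : Finset (Fin m))) :=
              convexHull_mono (Set.image_mono (by simp)) hxC
            rw [hT.2.1] at hx
            simp only [Set.mem_iUnion] at hx ⊢
            obtain ⟨σ, hσ, hx⟩ := hx
            refine ⟨σ, Finset.mem_filter.2 ⟨hσ, fun hσC => hxU ?_⟩, hx, hxC⟩
            rw [hU]
            simp only [Set.mem_iUnion]
            exact ⟨σ, Finset.mem_filter.2 ⟨hσ, hσC⟩, hx⟩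
          refine measure_mono_null hincl ?_
          refine (measure_biUnion_null_iff (Finset.countable_toSet _)).2 ?_
          intro σ hσ
          have hσ' := Finset.mem_filter.1 (Finset.mem_coe.1 hσ)
          by_contra hv
          exact hσ'.2 (hsub σ hσ'.1 C hC hv)
        have hopen : IsOpen (interior (convexHull ℝ (a '' ↑C)) \ U) :=
          isOpen_interior.sdiff hUc.isClosed
        have hempty : interior (convexHull ℝ (a '' ↑C)) \ U = ∅ := by
          by_contra hne
          have hpos := hopen.measure_pos volume (Set.nonempty_iff_ne_empty.2 hne)
          have hz : volume (interior (convexHull ℝ (a '' ↑C)) \ U) = 0 :=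
            measure_mono_null (Set.diff_subset_diff_left interior_subset) hnull
          exact hpos.ne' hz
        have hinter : (interior (convexHull ℝ (a '' ↑C))).Nonempty := by
          rw [interior_convexHull_nonempty_iff_affineSpan_eq_top]
          have hCne := (hL C hC).2.1.nonempty hm
          rw [AffineSubspace.affineSpan_eq_top_iff_vectorSpan_eq_top_of_nonempty]
          · apply Submodule.eq_top_of_finrank_eq
            have := maxCells_convDim hdim hC
            unfold convDim at this
            rw [this]
            simp
          · exact hCne.to_set.image a
        have hcl := (convex_convexHull ℝ (a '' ↑C)).closure_interior_eq_closure_of_nonempty_interior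
          hinter
        calc convexHull ℝ (a '' ↑C) ⊆ closure (convexHull ℝ (a '' ↑C)) := subset_closure
          _ = closure (interior (convexHull ℝ (a '' ↑C))) := hcl.symm
          _ ⊆ U := closure_minimal (Set.diff_eq_empty.1 hempty) hUc.isClosed
      · refine Set.iUnion₂_subset ?_
        intro σ hσ
        exact convexHull_mono (Set.image_mono (by exact_mod_cast (Finset.mem_filter.1 hσ).2))
    · intro σ hσ τ hτ
      exact hT.2.2 σ (Finset.mem_filter.1 hσ).1 τ (Finset.mem_filter.1 hτ).1
  · have huniq : ∀ σ ∈ T, ∃ C ∈ maxCells a ω, ∀ C' ∈ maxCells a ω, σ ⊆ C' ↔ C' = C := by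
      intro σ hσ
      have hinter := simplex_interior a σ (hs σ hσ).1 (hs σ hσ).2
      have hex : ∃ C ∈ maxCells a ω,
          volume (convexHull ℝ (a '' ↑σ) ∩ convexHull ℝ (a '' ↑C)) ≠ 0 := by
        by_contra hcon
        push Not at hcon
        have hz : volume (⋃ C ∈ maxCells a ω,
            convexHull ℝ (a '' ↑σ) ∩ convexHull ℝ (a '' ↑C)) = 0 :=
          (measure_biUnion_null_iff (Finset.countable_toSet _)).2 hcon
        rw [← Set.inter_iUnion₂, ← htile.cover, Set.inter_eq_left.2
          (convexHull_mono (Set.image_mono (by simp)))] at hz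
        have := isOpen_interior.measure_pos volume hinter
        exact this.ne' (measure_mono_null interior_subset hz)
      obtain ⟨C, hC, hv⟩ := hex
      have hσC := hsub σ hσ C hC hv
      refine ⟨C, hC, fun C' hC' => ⟨fun h => ?_, fun h => h ▸ hσC⟩⟩
      apply hL.inj hC' hC
      refine aff_eq_of_interior hinter _ _ ?_
      intro x hx
      refine aff_eq_on_hull a σ _ _ ?_ x (interior_subset hx)
      intro i hi
      rw [(hL.mem_iff hC' i).1 (h hi), (hL.mem_iff hC i).1 (hσC hi)]
    funext i
    rw [Finset.sum_apply]
    unfold gkzVector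
    simp only [Finset.sum_filter]
    rw [Finset.sum_comm]
    refine Finset.sum_congr rfl (fun σ hσ => ?_)
    obtain ⟨C, hC, h⟩ := huniq σ hσ
    rw [Finset.sum_eq_single_of_mem C hC, if_pos ((h C hC).2 rfl)]
    intro C' hC' hne
    rw [if_neg (fun h' => hne ((h C' hC').1 h'))]

end Cells

section Final

variable {d m : ℕ}

open MeasureTheory

/-- The linear functional attached to a weight vector. -/
noncomputable def pairFun (ω : Fin m → ℝ) : (Fin m → ℝ) →ₗ[ℝ] ℝ :=
  ∑ i, ω i • LinearMap.proj i

lemma pairFun_apply (ω p : Fin m → ℝ) : pairFun ω p = ∑ i, ω i * p i := by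
  simp [pairFun, LinearMap.sum_apply]

lemma pair_ge_on_hull {ω : Fin m → ℝ} {S : Set (Fin m → ℝ)} {c : ℝ}
    (h : ∀ s ∈ S, c ≤ ∑ i, ω i * s i) {p : Fin m → ℝ} (hp : p ∈ convexHull ℝ S) :
    c ≤ ∑ i, ω i * p i := by
  have h1 : convexHull ℝ S ⊆ {p | c ≤ pairFun ω p} := by
    refine convexHull_min (fun s hs => ?_) (convex_halfSpace_ge (pairFun ω).isLinear c)
    change c ≤ pairFun ω s
    rw [pairFun_apply]
    exact h s hs
  have h2 : c ≤ pairFun ω p := h1 hp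
  rwa [pairFun_apply] at h2

lemma pair_le_on_hull {ω : Fin m → ℝ} {S : Set (Fin m → ℝ)} {c : ℝ}
    (h : ∀ s ∈ S, ∑ i, ω i * s i ≤ c) {p : Fin m → ℝ} (hp : p ∈ convexHull ℝ S) :
    ∑ i, ω i * p i ≤ c := by
  have h1 : convexHull ℝ S ⊆ {p | pairFun ω p ≤ c} := by
    refine convexHull_min (fun s hs => ?_) (convex_halfSpace_le (pairFun ω).isLinear c)
    change pairFun ω s ≤ c
    rw [pairFun_apply]
    exact h s hs
  have h2 : pairFun ω p ≤ c := h1 hp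
  rwa [pairFun_apply] at h2

lemma exists_pair_le {ω : Fin m → ℝ} {S : Set (Fin m → ℝ)} {p : Fin m → ℝ}
    (hp : p ∈ convexHull ℝ S) : ∃ s ∈ S, ∑ i, ω i * s i ≤ ∑ i, ω i * p i := by
  by_contra hcon
  push Not at hcon
  have h1 : convexHull ℝ S ⊆ {q | pairFun ω p < pairFun ω q} := by
    refine convexHull_min (fun s hs => ?_) (convex_halfSpace_gt (pairFun ω).isLinear _)
    change pairFun ω p < pairFun ω s
    rw [pairFun_apply, pairFun_apply]
    exact hcon s hs
  have h2 : pairFun ω p < pairFun ω p := h1 hp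
  exact lt_irrefl _ h2

lemma pair_sum {ι : Type*} (s : Finset ι) (ω : Fin m → ℝ) (g : ι → Fin m → ℝ) :
    ∑ i, ω i * (∑ C ∈ s, g C) i = ∑ C ∈ s, ∑ i, ω i * g C i := by
  rw [← pairFun_apply, map_sum]
  exact Finset.sum_congr rfl (fun C _ => pairFun_apply _ _)

/-- The Minkowski sum of the secondary polytopes of the maximal cells. -/
noncomputable def minkSum (a : Fin m → (Fin d → ℝ)) (ω : Fin m → ℝ) : Set (Fin m → ℝ) :=
  ∑ C : Finset (Fin m), (if IsMaxCell a ω C then secondaryPolytope a C else 0)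

lemma mem_minkSum {a : Fin m → (Fin d → ℝ)} {ω x : Fin m → ℝ} :
    x ∈ minkSum a ω ↔ ∃ g : Finset (Fin m) → Fin m → ℝ,
      (∀ C ∈ maxCells a ω, g C ∈ secondaryPolytope a C) ∧ ∑ C ∈ maxCells a ω, g C = x := by
  unfold minkSum
  rw [Set.mem_fintype_sum]
  constructor
  · rintro ⟨g, hg, rfl⟩
    refine ⟨g, fun C hC => ?_, ?_⟩
    · have h := hg C
      rw [if_pos (by simpa [maxCells] using hC)] at h
      exact h
    · refine Finset.sum_subset (Finset.subset_univ _) (fun C _ hC => ?_)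
      have h := hg C
      rw [if_neg (by simpa [maxCells] using hC)] at h
      simpa using h
  · rintro ⟨g, hg, rfl⟩
    refine ⟨fun C => if C ∈ maxCells a ω then g C else 0, fun C => ?_, ?_⟩
    · by_cases hC : C ∈ maxCells a ω
      · have hC' : IsMaxCell a ω C := by simpa [maxCells] using hC
        simp only [if_pos hC, if_pos hC']
        exact hg C hC
      · have hC' : ¬ IsMaxCell a ω C := by simpa [maxCells] using hC
        simp only [if_neg hC, if_neg hC']
        simp
    · rw [← Finset.sum_filter]
      congr 1
      ext C
      simp

lemma minkSum_nonempty (a : Fin m → (Fin d → ℝ)) (ω : Fin m → ℝ) : (minkSum a ω).Nonempty := by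
  choose g hg using fun C => secondaryPolytope_nonempty a C
  exact ⟨_, mem_minkSum.2 ⟨g, fun C _ => hg C, rfl⟩⟩

lemma minkSum_convex (a : Fin m → (Fin d → ℝ)) (ω : Fin m → ℝ) : Convex ℝ (minkSum a ω) := by
  unfold minkSum
  refine convex_sum _ (fun C _ => ?_)
  split_ifs
  · exact convex_convexHull _ _
  · exact convex_zero

lemma secondaryPolytope_closed (a : Fin m → (Fin d → ℝ)) (C : Finset (Fin m)) :
    IsClosed (secondaryPolytope a C) := by
  have hf : {φ : Fin m → ℝ | ∃ T : Finset (Finset (Fin m)), IsTriangulation a C T ∧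
      φ = gkzVector a T}.Finite := by
    refine (Set.finite_range (gkzVector a)).subset ?_
    rintro _ ⟨T, _, rfl⟩
    exact ⟨T, rfl⟩
  exact hf.isClosed_convexHull ℝ

lemma minkSum_subset (hm : (Finset.univ : Finset (Fin m)).Nonempty) {a : Fin m → (Fin d → ℝ)}
    {ω : Fin m → ℝ} {L : Finset (Fin m) → (Fin d → ℝ) →ᵃ[ℝ] ℝ} (hL : CellFun a ω L)
    (hdim : convDim a Finset.univ = d) {x : Fin m → ℝ} (hx : x ∈ minkSum a ω) :
    x ∈ secondaryPolytope a Finset.univ := by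
  by_contra hcon
  obtain ⟨g, hg, rfl⟩ := mem_minkSum.1 hx
  set x := ∑ C ∈ maxCells a ω, g C with hxdef
  obtain ⟨f, u, hfu, hu⟩ := geometric_hahn_banach_point_closed
    (convex_convexHull ℝ _) (secondaryPolytope_closed a Finset.univ) hcon
  set ψ : Fin m → ℝ := fun i => f (Pi.single i 1) with hψ
  have hf : ∀ y : Fin m → ℝ, f y = ∑ i, ψ i * y i := by
    intro y
    have h1 : y = ∑ i, y i • (Pi.single i (1:ℝ) : Fin m → ℝ) := by
      ext j
      simp [Finset.sum_apply, Pi.single_apply]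
    conv_lhs => rw [h1]
    rw [map_sum]
    refine Finset.sum_congr rfl (fun i _ => ?_)
    rw [map_smul, smul_eq_mul, mul_comm]
  let ψt : ℝ → Fin m → ℝ := fun t i => ψ i + t ^ (i.val + 1)
  have hcont : ∀ y : Fin m → ℝ, Continuous (fun t => ∑ i, ψt t i * y i) := by
    intro y
    simp only [ψt]
    fun_prop
  have h0 : ψt 0 = ψ := by
    ext i
    simp [ψt]
  have hev : ∀ᶠ t in nhdsWithin (0:ℝ) {0}ᶜ, ∀ T : Finset (Finset (Fin m)),
      IsTriangulation a Finset.univ T →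
        ∑ i, ψt t i * x i < ∑ i, ψt t i * gkzVector a T i := by
    refine Filter.Eventually.filter_mono nhdsWithin_le_nhds ?_
    rw [Filter.eventually_all]
    intro T
    by_cases hT : IsTriangulation a Finset.univ T
    · have hlt : ∑ i, ψt 0 i * x i < ∑ i, ψt 0 i * gkzVector a T i := by
        rw [h0, ← hf, ← hf]
        exact hfu.trans (hu _ (subset_convexHull ℝ _ ⟨T, hT, rfl⟩))
      have := ((hcont x).tendsto 0).eventually_lt ((hcont (gkzVector a T)).tendsto 0) hlt
      exact this.mono (fun t ht _ => ht)
    · exact Filter.Eventually.of_forall (fun t h => absurd h hT)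
  obtain ⟨t, ht, hgen⟩ := (hev.and (eventually_generic a ψ)).exists
  have hch : ∀ C, ∃ T, C ∈ maxCells a ω → (IsTriangulation a C T ∧
      ∑ i, ψt t i * gkzVector a T i ≤ ∑ i, ψt t i * g C i) := by
    intro C
    by_cases hC : C ∈ maxCells a ω
    · obtain ⟨s, ⟨T, hT, rfl⟩, hs⟩ := exists_pair_le (ω := ψt t) (hg C hC)
      exact ⟨T, fun _ => ⟨hT, hs⟩⟩
    · exact ⟨∅, fun h => absurd h hC⟩
  choose T hT using hch
  have hle := union_lower hm hL hdim T (fun C hC => (hT C hC).1) (ψt t) hgen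
  have hlt := ht _ (regTriang_isTriangulation a Finset.univ (ψt t) hm hgen)
  have hsum : ∑ C ∈ maxCells a ω, ∑ i, ψt t i * gkzVector a (T C) i ≤ ∑ i, ψt t i * x i := by
    rw [hxdef, pair_sum]
    exact Finset.sum_le_sum (fun C hC => (hT C hC).2)
  linarith

lemma minkSum_value {a : Fin m → (Fin d → ℝ)}
    {ω : Fin m → ℝ} {L : Finset (Fin m) → (Fin d → ℝ) →ᵃ[ℝ] ℝ} (hL : CellFun a ω L)
    (hdim : convDim a Finset.univ = d) {x : Fin m → ℝ} (hx : x ∈ minkSum a ω) :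
    ∑ i, ω i * x i = minValue a ω L := by
  obtain ⟨g, hg, rfl⟩ := mem_minkSum.1 hx
  rw [pair_sum, minValue, Finset.mul_sum]
  refine Finset.sum_congr rfl (fun C hC => le_antisymm ?_ ?_)
  · refine pair_le_on_hull ?_ (hg C hC)
    rintro _ ⟨T, hT, rfl⟩
    exact (cell_value hL hdim hC hT).le
  · refine pair_ge_on_hull ?_ (hg C hC)
    rintro _ ⟨T, hT, rfl⟩
    exact (cell_value hL hdim hC hT).ge

lemma main_case (hm : (Finset.univ : Finset (Fin m)).Nonempty) (a : Fin m → (Fin d → ℝ))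
    (ω : Fin m → ℝ) (hdim : convDim a Finset.univ = d) :
    {p ∈ secondaryPolytope a Finset.univ | ∀ q ∈ secondaryPolytope a Finset.univ,
        ∑ i, ω i * p i ≤ ∑ i, ω i * q i} = minkSum a ω := by
  obtain ⟨L, hL⟩ := exists_cellFun hm a ω
  have hlow : ∀ q ∈ secondaryPolytope a Finset.univ, minValue a ω L ≤ ∑ i, ω i * q i := by
    intro q hq
    refine pair_ge_on_hull ?_ hq
    rintro _ ⟨T, hT, rfl⟩
    exact (lower_bound hm hL hdim hT).1
  apply Set.Subset.antisymm
  · rintro p ⟨hp, hmin⟩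
    obtain ⟨x0, hx0⟩ := minkSum_nonempty a ω
    have h1 := hmin x0 (minkSum_subset hm hL hdim hx0)
    rw [minkSum_value hL hdim hx0] at h1
    have h2 := le_antisymm h1 (hlow p hp)
    let h : (Fin m → ℝ) →ᵃ[ℝ] ℝ :=
      (pairFun ω).toAffineMap - AffineMap.const ℝ _ (minValue a ω L)
    have hh : ∀ y, h y = ∑ i, ω i * y i - minValue a ω L := by
      intro y
      simp [h, pairFun_apply]
    have h3 := hull_zero_face_set _ h (by
      rintro _ ⟨T, hT, rfl⟩
      rw [hh]
      have := (lower_bound hm hL hdim hT).1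
      linarith) p hp (by rw [hh]; linarith)
    refine convexHull_min ?_ (minkSum_convex a ω) h3
    rintro _ ⟨⟨T, hT, rfl⟩, hz⟩
    rw [hh] at hz
    obtain ⟨k1, k2⟩ := refine_cells hm hL hdim hT (by linarith)
    exact mem_minkSum.2 ⟨fun C => gkzVector a (T.filter (fun σ => σ ⊆ C)),
      fun C hC => subset_convexHull ℝ _ ⟨_, k1 C hC, rfl⟩, k2.symm⟩
  · intro x hx
    refine ⟨minkSum_subset hm hL hdim hx, fun q hq => ?_⟩
    rw [minkSum_value hL hdim hx]
    exact hlow q hq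

lemma gkz_zero_of_dim {a : Fin m → (Fin d → ℝ)} (hdim : convDim a Finset.univ ≠ d)
    (T : Finset (Finset (Fin m))) : gkzVector a T = 0 := by
  have hv : ∀ σ : Finset (Fin m), volume (convexHull ℝ (a '' ↑σ)) = 0 := by
    intro σ
    by_contra hv
    have hinter := interior_nonempty_of_volume (convex_convexHull ℝ (a '' ↑σ)) hv
    rw [interior_convexHull_nonempty_iff_affineSpan_eq_top] at hinter
    apply hdim
    have h1 : vectorSpan ℝ (a '' ↑σ) = ⊤ := by
      rw [← direction_affineSpan, hinter, AffineSubspace.direction_top]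
    have h2 : vectorSpan ℝ (a '' ↑(Finset.univ : Finset (Fin m))) = ⊤ := by
      rw [eq_top_iff, ← h1]
      exact vectorSpan_mono ℝ (Set.image_mono (by simp))
    unfold convDim
    rw [h2]
    simp
  ext i
  simp [gkzVector, hv]

lemma secondaryPolytope_sub_zero {a : Fin m → (Fin d → ℝ)} (hdim : convDim a Finset.univ ≠ d)
    {C : Finset (Fin m)} {x : Fin m → ℝ} (hx : x ∈ secondaryPolytope a C) : x = 0 := by
  have h : secondaryPolytope a C ⊆ {0} := by
    refine convexHull_min ?_ (convex_singleton 0)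
    rintro _ ⟨T, _, rfl⟩
    exact gkz_zero_of_dim hdim T
  exact h hx

end Final

/-- A face of the secondary polytope is a Minkowski sum of secondary polytopes: the
face of `Σ(A)` on which the linear functional `ω` is minimized equals the Minkowski sum
of the secondary polytopes of the maximal cells of the regular subdivision `Δ_ω` of `A`
induced by `ω`. -/
theorem secondary_face_eq_minkowski_sum {d m : ℕ} (a : Fin m → (Fin d → ℝ))
    (ω : Fin m → ℝ) :
    {p ∈ secondaryPolytope a Finset.univ | ∀ q ∈ secondaryPolytope a Finset.univ,
        ∑ i, ω i * p i ≤ ∑ i, ω i * q i} =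
    ∑ C : Finset (Fin m), (if IsMaxCell a ω C then secondaryPolytope a C else 0) := by
  change _ = minkSum a ω
  rcases (Finset.univ : Finset (Fin m)).eq_empty_or_nonempty with hm | hm
  · have hem : IsEmpty (Fin m) := Finset.univ_eq_empty_iff.1 hm
    have hss : Subsingleton (Fin m → ℝ) := inferInstance
    obtain ⟨x, hx⟩ := minkSum_nonempty a ω
    obtain ⟨y, hy⟩ := secondaryPolytope_nonempty a Finset.univ
    ext p
    constructor
    · intro _
      rwa [hss.elim p x]
    · intro _
      refine ⟨?_, fun q _ => ?_⟩
      · rwa [hss.elim p y]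
      · rw [hss.elim p q]
  · by_cases hdim : convDim a Finset.univ = d
    · exact main_case hm a ω hdim
    · have hz : ∀ x ∈ minkSum a ω, x = 0 := by
        intro x hx
        obtain ⟨g, hg, rfl⟩ := mem_minkSum.1 hx
        exact Finset.sum_eq_zero (fun C hC => secondaryPolytope_sub_zero hdim (hg C hC))
      obtain ⟨x, hx⟩ := minkSum_nonempty a ω
      obtain ⟨y, hy⟩ := secondaryPolytope_nonempty a Finset.univ
      rw [hz x hx] at hx
      rw [secondaryPolytope_sub_zero hdim hy] at hy
      ext p
      constructor
      · rintro ⟨hp, _⟩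
        rwa [secondaryPolytope_sub_zero hdim hp]
      · intro hp
        rw [hz p hp]
        refine ⟨hy, fun q hq => ?_⟩
        rw [secondaryPolytope_sub_zero hdim hq]
end

section
/- Let A_1, ..., A_n be finite subsets of ℤ^n (or ℚ^n). Then the mixed volume of the convex hulls Q_1,...,Q_n is nonzero if and only if there exists a choice of two-element subsets E_i ⊆ A_i such that the Minkowski sum of the segments conv(E_1) + ... + conv(E_n) is n-dimensional. -/
open scoped Pointwise

/-- The mixed volume of the convex hulls of `A 1, ..., A n`, defined by the standard
inclusion–exclusion formula `MV = ∑_{I ⊆ [n]} (-1)^{n-|I|} vol(∑_{i ∈ I} Q i)` (a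
standard normalization; only nonvanishing matters). -/
noncomputable def mixedVol (n : ℕ) (A : Fin n → Finset (Fin n → ℤ)) : ℝ :=
  ∑ I : Finset (Fin n), (-1 : ℝ) ^ (n - I.card) *
    (MeasureTheory.volume
      (∑ i ∈ I, convexHull ℝ ((fun v : Fin n → ℤ => fun t => (v t : ℝ)) '' ↑(A i)))).toReal


lemma mv_alt_sum (n : ℕ) (T : Finset (Fin n)) :
    (∑ I : Finset (Fin n), (-1 : ℝ) ^ (n - I.card) * (if T ⊆ I then 1 else 0))
      = if T = Finset.univ then 1 else 0 := by
  classical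
  have h1 : (∑ I : Finset (Fin n), (-1 : ℝ) ^ (n - I.card) * (if T ⊆ I then 1 else 0))
      = ∑ J : Finset (Fin n), (-1 : ℝ) ^ J.card * (if J ⊆ Tᶜ then 1 else 0) := by
    refine Fintype.sum_equiv (Function.Involutive.toPerm compl compl_involutive) _ _ ?_
    intro I
    change _ = (-1 : ℝ) ^ (Iᶜ).card * (if Iᶜ ⊆ Tᶜ then 1 else 0)
    rw [Finset.card_compl, Fintype.card_fin]
    congr 1
    by_cases h : T ⊆ I
    · rw [if_pos h, if_pos (Finset.compl_subset_compl.2 h)]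
    · rw [if_neg h, if_neg (fun h' => h (Finset.compl_subset_compl.1 h'))]
  rw [h1]
  have h2 : (∑ J : Finset (Fin n), (-1 : ℝ) ^ J.card * (if J ⊆ Tᶜ then 1 else 0))
      = ∑ J ∈ (Tᶜ).powerset, (-1 : ℝ) ^ J.card := by
    simp only [mul_ite, mul_one, mul_zero]
    rw [← Finset.sum_filter]
    congr 1
    ext J; simp
  rw [h2]
  have h3 := Finset.sum_powerset_neg_one_pow_card (x := Tᶜ)
  have h4 : (∑ J ∈ (Tᶜ).powerset, (-1 : ℝ) ^ J.card)
      = ((∑ J ∈ (Tᶜ).powerset, (-1 : ℤ) ^ J.card : ℤ) : ℝ) := by push_cast; rfl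
  rw [h4, h3]
  simp only [Finset.compl_eq_empty_iff]
  split_ifs <;> simp

lemma mv_polar (n : ℕ) (M : Fin n → Matrix (Fin n) (Fin n) ℝ) :
    (∑ I : Finset (Fin n), (-1 : ℝ) ^ (n - I.card) * (∑ i ∈ I, M i).det)
      = ∑ σ : Equiv.Perm (Fin n), ((Equiv.Perm.sign σ : ℤ) : ℝ) *
          (Matrix.of fun i => M i (σ i)).det := by
  classical
  have h1 : ∀ I : Finset (Fin n), (∑ i ∈ I, M i).det
      = ∑ g : Fin n → Fin n, (if Finset.univ.image g ⊆ I then 1 else 0) *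
          (Matrix.of fun r => M (g r) r).det := by
    intro I
    have := (Matrix.detRowAlternating (n := Fin n) (R := ℝ)).toMultilinearMap.map_sum_finset
      (fun r i => M i r) (fun _ => I)
    have e : (∑ i ∈ I, M i).det = (Matrix.detRowAlternating (n := Fin n) (R := ℝ)).toMultilinearMap
        (fun r => ∑ i ∈ I, M i r) := by
      change Matrix.det _ = Matrix.det _
      congr 1
      ext r s
      simp [Matrix.sum_apply]
    rw [e, this]
    simp only [ite_mul, one_mul, zero_mul]
    rw [← Finset.sum_filter]
    refine Finset.sum_congr ?_ (fun g _ => rfl)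
    ext g
    simp [Fintype.mem_piFinset, Finset.image_subset_iff]
  simp_rw [h1, Finset.mul_sum]
  rw [Finset.sum_comm]
  have h2 : ∀ g : Fin n → Fin n, (∑ I : Finset (Fin n), (-1 : ℝ) ^ (n - I.card) *
      ((if Finset.univ.image g ⊆ I then 1 else 0) * (Matrix.of fun r => M (g r) r).det))
      = if Function.Bijective g then (Matrix.of fun r => M (g r) r).det else 0 := by
    intro g
    simp_rw [← mul_assoc]
    rw [← Finset.sum_mul, mv_alt_sum]
    have : Finset.univ.image g = Finset.univ ↔ Function.Bijective g := by
      rw [← Finite.surjective_iff_bijective, Finset.eq_univ_iff_forall]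
      simp [Function.Surjective]
    simp only [this]
    split_ifs <;> simp
  simp_rw [h2]
  rw [← Finset.sum_filter]
  have h3 : ∑ g : Fin n → Fin n with Function.Bijective g, (Matrix.of fun r => M (g r) r).det
      = ∑ σ : Equiv.Perm (Fin n), (Matrix.of fun r => M (σ r) r).det := by
    symm
    refine Finset.sum_bij (fun σ _ => (σ : Fin n → Fin n)) ?_ ?_ ?_ ?_
    · intro σ _; exact Finset.mem_filter.2 ⟨Finset.mem_univ _, σ.bijective⟩
    · intro σ _ τ _ h; exact DFunLike.coe_injective h
    · intro g hg
      exact ⟨Equiv.ofBijective g (Finset.mem_filter.1 hg).2, by simp, rfl⟩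
    · intro σ _; rfl
  rw [h3]
  refine Fintype.sum_equiv (Equiv.inv (Equiv.Perm (Fin n))) _ _ ?_
  intro σ
  have := Matrix.det_permute σ (Matrix.of fun i => M i (σ⁻¹ i))
  simp only [Equiv.inv_apply, Equiv.Perm.sign_inv]
  rw [← this]
  congr 1
  ext r s
  simp [Matrix.submatrix]

lemma mv_rankone {κ : Type*} (n : ℕ) (K : Fin n → Finset κ) (w : Fin n → κ → ℝ)
    (v : κ → Fin n → ℝ) :
    (∑ I : Finset (Fin n), (-1 : ℝ) ^ (n - I.card) *
      (∑ i ∈ I, ∑ k ∈ K i, w i k • Matrix.vecMulVec (v k) (v k)).det)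
      = ∑ k ∈ Fintype.piFinset K, (∏ i, w i (k i)) *
          (Matrix.of fun i => v (k i)).det ^ 2 := by
  classical
  rw [mv_polar]
  have h1 : ∀ σ : Equiv.Perm (Fin n),
      (Matrix.of fun i => (∑ k ∈ K i, w i k • Matrix.vecMulVec (v k) (v k)) (σ i)).det
      = ∑ k ∈ Fintype.piFinset K, (∏ i, (w i (k i) * v (k i) (σ i))) *
          (Matrix.of fun i => v (k i)).det := by
    intro σ
    have := (Matrix.detRowAlternating (n := Fin n) (R := ℝ)).toMultilinearMap.map_sum_finset
      (fun i k => (w i k * v k (σ i)) • v k) K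
    have e : (Matrix.of fun i => (∑ k ∈ K i, w i k • Matrix.vecMulVec (v k) (v k)) (σ i)).det
       = (Matrix.detRowAlternating (n := Fin n) (R := ℝ)).toMultilinearMap
        (fun i => ∑ k ∈ K i, (w i k * v k (σ i)) • v k) := by
      change Matrix.det _ = Matrix.det _
      congr 1
      ext r s
      simp [Matrix.sum_apply, Matrix.vecMulVec_apply, mul_assoc]
    rw [e, this]
    refine Finset.sum_congr rfl fun k _ => ?_
    rw [MultilinearMap.map_smul_univ]
    rfl
  simp_rw [h1, Finset.mul_sum]
  rw [Finset.sum_comm]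
  refine Finset.sum_congr rfl fun k _ => ?_
  have h2 : (Matrix.of fun i => v (k i)).det
      = ∑ σ : Equiv.Perm (Fin n), ((Equiv.Perm.sign σ : ℤ) : ℝ) * ∏ i, v (k i) (σ i) := by
    rw [← Matrix.det_transpose, Matrix.det_apply']
    rfl
  generalize (Matrix.of fun i => v (k i)).det = d at h2 ⊢
  have h4 : (∏ i, w i (k i)) * d ^ 2 = ((∏ i, w i (k i)) * d) * d := by ring
  rw [h4]
  conv_rhs => rw [h2, mul_comm, Finset.sum_mul]
  rw [← h2]
  refine Finset.sum_congr rfl fun σ _ => ?_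
  rw [Finset.prod_mul_distrib]
  ring

section analysis
variable {α : Type*} {n : ℕ} (p : α → Fin n → ℝ)

/-- The linear functional `h ↦ v ⬝ᵥ h`. -/
noncomputable def mvL (v : Fin n → ℝ) : (Fin n → ℝ) →L[ℝ] ℝ :=
  ∑ i, v i • ContinuousLinearMap.proj (R := ℝ) (φ := fun _ : Fin n => ℝ) i

lemma mvL_apply (v h : Fin n → ℝ) : mvL v h = v ⬝ᵥ h := by
  simp [mvL, dotProduct]

/-- Log-sum-exp. -/
noncomputable def mvLse (S : Finset α) (y : Fin n → ℝ) : ℝ :=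
  Real.log (∑ a ∈ S, Real.exp (mvL (p a) y))

/-- Gibbs weights. -/
noncomputable def mvW (S : Finset α) (a : α) (y : Fin n → ℝ) : ℝ :=
  Real.exp (mvL (p a) y - mvLse p S y)

/-- Gibbs mean, the gradient of log-sum-exp. -/
noncomputable def mvMean (S : Finset α) (y : Fin n → ℝ) : Fin n → ℝ :=
  ∑ a ∈ S, mvW p S a y • p a

/-- Covariance matrix, the Hessian of log-sum-exp. -/
noncomputable def mvHess (S : Finset α) (y : Fin n → ℝ) : Matrix (Fin n) (Fin n) ℝ :=
  ∑ k ∈ S ×ˢ S, (2⁻¹ * (mvW p S k.1 y * mvW p S k.2 y)) •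
    Matrix.vecMulVec (p k.1 - p k.2) (p k.1 - p k.2)

lemma mvW_pos (S : Finset α) (a : α) (y : Fin n → ℝ) : 0 < mvW p S a y := Real.exp_pos _

lemma mvZ_pos {S : Finset α} (hS : S.Nonempty) (y : Fin n → ℝ) :
    0 < ∑ a ∈ S, Real.exp (mvL (p a) y) :=
  Finset.sum_pos (fun _ _ => Real.exp_pos _) hS

lemma mvW_eq {S : Finset α} (hS : S.Nonempty) (a : α) (y : Fin n → ℝ) :
    mvW p S a y = (∑ a ∈ S, Real.exp (mvL (p a) y))⁻¹ * Real.exp (mvL (p a) y) := by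
  rw [mvW, mvLse, Real.exp_sub, Real.exp_log (mvZ_pos p hS y)]
  field_simp

lemma mvW_sum {S : Finset α} (hS : S.Nonempty) (y : Fin n → ℝ) :
    ∑ a ∈ S, mvW p S a y = 1 := by
  simp_rw [mvW_eq p hS]
  rw [← Finset.mul_sum, inv_mul_cancel₀ (mvZ_pos p hS y).ne']

lemma mvLse_ge {S : Finset α} {a : α} (ha : a ∈ S) (y : Fin n → ℝ) :
    mvL (p a) y ≤ mvLse p S y := by
  rw [mvLse, Real.le_log_iff_exp_le (mvZ_pos p ⟨a, ha⟩ y)]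
  exact Finset.single_le_sum (f := fun a => Real.exp (mvL (p a) y))
    (fun _ _ => (Real.exp_pos _).le) ha

lemma mvL_mean (S : Finset α) (y h : Fin n → ℝ) :
    mvL (mvMean p S y) h = ∑ a ∈ S, mvW p S a y * mvL (p a) h := by
  simp only [mvL_apply, mvMean, sum_dotProduct, smul_dotProduct, smul_eq_mul]

lemma mvLse_hasFDerivAt {S : Finset α} (hS : S.Nonempty) (y : Fin n → ℝ) :
    HasFDerivAt (mvLse p S) (mvL (mvMean p S y)) y := by
  have h := (HasFDerivAt.fun_sum (u := S)
    (fun a _ => ((mvL (p a)).hasFDerivAt (x := y)).exp)).log (mvZ_pos p hS y).ne'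
  refine h.congr_fderiv ?_
  ext1 h
  rw [mvL_mean]
  simp only [smul_apply, sum_apply, smul_eq_mul,
    mvW_eq p hS, Finset.mul_sum, mul_assoc]

lemma mvW_hasFDerivAt {S : Finset α} (hS : S.Nonempty) (a : α) (y : Fin n → ℝ) :
    HasFDerivAt (mvW p S a) (mvW p S a y • (mvL (p a) - mvL (mvMean p S y))) y :=
  (((mvL (p a)).hasFDerivAt (x := y)).sub (mvLse_hasFDerivAt p hS y)).exp

lemma mvHess_mulVec {S : Finset α} (hS : S.Nonempty) (y h : Fin n → ℝ) :
    (mvHess p S y).mulVec h = ∑ a ∈ S, (mvW p S a y * (mvL (p a) h - mvL (mvMean p S y) h)) • p a := by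
  have h1 : (mvHess p S y).mulVec h = ∑ a ∈ S, ∑ b ∈ S,
      (2⁻¹ * (mvW p S a y * mvW p S b y) * (mvL (p a) h - mvL (p b) h)) • (p a - p b) := by
    rw [mvHess, Matrix.sum_mulVec, Finset.sum_product]
    refine Finset.sum_congr rfl fun a _ => Finset.sum_congr rfl fun b _ => ?_
    rw [Matrix.smul_mulVec, Matrix.vecMulVec_mulVec, op_smul_eq_smul, smul_smul, sub_dotProduct,
      mvL_apply, mvL_apply]
  rw [h1, mvL_mean]
  have h2 : ∀ a b, (2⁻¹ * (mvW p S a y * mvW p S b y) * (mvL (p a) h - mvL (p b) h)) • (p a - p b)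
      = (2⁻¹ * (mvW p S a y * mvW p S b y) * (mvL (p a) h - mvL (p b) h)) • p a
      + (2⁻¹ * (mvW p S b y * mvW p S a y) * (mvL (p b) h - mvL (p a) h)) • p b := by
    intro a b
    rw [smul_sub, sub_eq_add_neg, ← neg_smul]
    congr 2
    ring
  simp_rw [h2, Finset.sum_add_distrib]
  conv_lhs => 
    arg 2
    rw [Finset.sum_comm]
  rw [← Finset.sum_add_distrib]
  refine Finset.sum_congr rfl fun a _ => ?_
  rw [← Finset.sum_smul, ← add_smul]
  congr 1
  have h3 : ∀ b, 2⁻¹ * (mvW p S a y * mvW p S b y) * (mvL (p a) h - mvL (p b) h)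
    = 2⁻¹ * mvW p S a y * (mvW p S b y * mvL (p a) h - mvW p S b y * mvL (p b) h) := by
    intro b; ring
  simp_rw [h3]
  rw [← Finset.mul_sum, Finset.sum_sub_distrib, ← Finset.sum_mul, mvW_sum p hS]
  ring

lemma mvMean_hasFDerivAt {S : Finset α} (hS : S.Nonempty) (y : Fin n → ℝ) :
    HasFDerivAt (mvMean p S) (LinearMap.toContinuousLinearMap (Matrix.toLin' (mvHess p S y))) y := by
  have h := HasFDerivAt.fun_sum (u := S)
    (fun a _ => (mvW_hasFDerivAt p hS a y).smul_const (p a))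
  refine h.congr_fderiv ?_
  ext1 h
  simp only [LinearMap.coe_toContinuousLinearMap', Matrix.toLin'_apply, mvHess_mulVec p hS]
  simp

lemma mvLse_continuous {S : Finset α} (hS : S.Nonempty) : Continuous (mvLse p S) :=
  continuous_iff_continuousAt.2 fun y => (mvLse_hasFDerivAt p hS y).continuousAt

lemma mvW_continuous {S : Finset α} (hS : S.Nonempty) (a : α) : Continuous (mvW p S a) :=
  continuous_iff_continuousAt.2 fun y => (mvW_hasFDerivAt p hS a y).continuousAt

lemma mvHess_continuous {S : Finset α} (hS : S.Nonempty) : Continuous (mvHess p S) := by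
  unfold mvHess
  refine continuous_finsetSum _ fun k _ => ?_
  exact (continuous_const.mul ((mvW_continuous p hS _).mul (mvW_continuous p hS _))).smul
    continuous_const

lemma mvHess_quad (S : Finset α) (y h : Fin n → ℝ) :
    h ⬝ᵥ (mvHess p S y).mulVec h = ∑ k ∈ S ×ˢ S,
      (2⁻¹ * (mvW p S k.1 y * mvW p S k.2 y)) * (mvL (p k.1 - p k.2) h) ^ 2 := by
  rw [mvHess, Matrix.sum_mulVec, dotProduct_sum]
  refine Finset.sum_congr rfl fun k _ => ?_
  rw [Matrix.smul_mulVec, Matrix.vecMulVec_mulVec, op_smul_eq_smul, dotProduct_smul,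
    dotProduct_smul, mvL_apply, dotProduct_comm h, smul_eq_mul, smul_eq_mul]
  ring

lemma mvHess_symm (S : Finset α) (y : Fin n → ℝ) : (mvHess p S y).IsHermitian := by
  unfold mvHess
  rw [Matrix.IsHermitian, Matrix.conjTranspose_sum]
  refine Finset.sum_congr rfl fun k _ => ?_
  ext i j
  simp [Matrix.vecMulVec_apply, mul_comm]

end analysis

section bodies
variable {α : Type*} {n : ℕ} (p : α → Fin n → ℝ) {A : Fin n → Finset α}

lemma mvMean_mem {S : Finset α} (hS : S.Nonempty) (y : Fin n → ℝ) :
    mvMean p S y ∈ convexHull ℝ (p '' (S : Set α)) :=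
  (convex_convexHull ℝ _).sum_mem (fun a _ => (mvW_pos p S a y).le) (mvW_sum p hS y)
    (fun a ha => subset_convexHull ℝ _ ⟨a, ha, rfl⟩)

lemma mvL_comm (v h : Fin n → ℝ) : mvL v h = mvL h v := by
  rw [mvL_apply, mvL_apply, dotProduct_comm]

lemma mvLse_ge_hull {S : Finset α} {q : Fin n → ℝ} (hq : q ∈ convexHull ℝ (p '' (S : Set α)))
    (y : Fin n → ℝ) : mvL q y ≤ mvLse p S y := by
  have h : convexHull ℝ (p '' (S : Set α)) ⊆ {q | mvL y q ≤ mvLse p S y} := by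
    refine convexHull_min ?_ (convex_halfSpace_le (mvL y).toLinearMap.isLinear _)
    rintro _ ⟨a, ha, rfl⟩
    rw [Set.mem_ofPred_eq, mvL_comm]
    exact mvLse_ge p ha y
  rw [mvL_comm]
  exact h hq

lemma mvL_sum_left {ι : Type*} (I : Finset ι) (g : ι → Fin n → ℝ) (y : Fin n → ℝ) :
    mvL (∑ i ∈ I, g i) y = ∑ i ∈ I, mvL (g i) y := by
  simp only [mvL_apply, sum_dotProduct]

lemma mvF_hasFDerivAt (hA : ∀ i, (A i).Nonempty) (I : Finset (Fin n)) (y : Fin n → ℝ) :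
    HasFDerivAt (fun y => ∑ i ∈ I, mvMean p (A i) y)
      (LinearMap.toContinuousLinearMap (Matrix.toLin' (∑ i ∈ I, mvHess p (A i) y))) y := by
  refine (HasFDerivAt.fun_sum (u := I) (fun i _ => mvMean_hasFDerivAt p (hA i) y)).congr_fderiv ?_
  ext1 h
  simp

lemma mvH_quad (I : Finset (Fin n)) (y h : Fin n → ℝ) :
    h ⬝ᵥ (∑ i ∈ I, mvHess p (A i) y).mulVec h = ∑ i ∈ I, ∑ k ∈ A i ×ˢ A i,
      (2⁻¹ * (mvW p (A i) k.1 y * mvW p (A i) k.2 y)) * (mvL (p k.1 - p k.2) h) ^ 2 := by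
  rw [Matrix.sum_mulVec, dotProduct_sum]
  exact Finset.sum_congr rfl fun i _ => mvHess_quad p (A i) y h

lemma mvH_symm (I : Finset (Fin n)) (y : Fin n → ℝ) :
    (∑ i ∈ I, mvHess p (A i) y).IsHermitian := by
  rw [Matrix.IsHermitian, Matrix.conjTranspose_sum]
  exact Finset.sum_congr rfl fun i _ => mvHess_symm p (A i) y

lemma mv_surj (hA : ∀ i, (A i).Nonempty) (I : Finset (Fin n)) {x : Fin n → ℝ}
    (hx : x ∈ interior (∑ i ∈ I, convexHull ℝ (p '' (A i : Set α)))) :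
    ∃ y, ∑ i ∈ I, mvMean p (A i) y = x := by
  obtain ⟨r, hr, hball⟩ := Metric.mem_nhds_iff.1 (mem_interior_iff_mem_nhds.1 hx)
  set g : (Fin n → ℝ) → ℝ := fun y => (∑ i ∈ I, mvLse p (A i) y) - mvL x y with hg
  have hlow : ∀ q ∈ ∑ i ∈ I, convexHull ℝ (p '' (A i : Set α)), ∀ y,
      mvL q y ≤ ∑ i ∈ I, mvLse p (A i) y := by
    intro q hq y
    obtain ⟨u, hu, rfl⟩ := (Set.mem_finsetSum _ _ _).1 hq
    rw [mvL_sum_left]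
    exact Finset.sum_le_sum fun i hi => mvLse_ge_hull p (hu hi) y
  have hderiv : ∀ y, HasFDerivAt g (mvL (∑ i ∈ I, mvMean p (A i) y - x)) y := by
    intro y
    refine ((HasFDerivAt.fun_sum (u := I) (fun i _ => mvLse_hasFDerivAt p (hA i) y)).sub
      ((mvL x).hasFDerivAt (x := y))).congr_fderiv ?_
    ext1 h
    simp [mvL_apply, sub_dotProduct, sum_dotProduct]
  have hcont : Continuous g :=
    continuous_iff_continuousAt.2 fun y => (hderiv y).continuousAt
  -- coercivity
  have hco : ∀ y, (r / 2) * ‖y‖ ≤ g y := by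
    intro y
    have hi : ∀ i, (r / 2) * ‖y i‖ ≤ g y := by
      intro i
      set q : Fin n → ℝ := x + Pi.single i (r / 2 * SignType.sign (y i)) with hq
      have hq' : q ∈ Metric.ball x r := by
        rw [Metric.mem_ball, dist_eq_norm, hq, add_sub_cancel_left]
        rw [Pi.norm_single, norm_mul, Real.norm_of_nonneg (by positivity)]
        have : ‖((SignType.sign (y i) : SignType) : ℝ)‖ ≤ 1 := by
          rcases SignType.sign (y i) <;> simp
        nlinarith
      have h1 := hlow q (hball hq') y
      have h2 : mvL q y = mvL x y + r / 2 * ‖y i‖ := by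
        rw [mvL_apply, mvL_apply, hq, add_dotProduct, single_dotProduct, mul_assoc,
          sign_mul_self]
        rfl
      rw [hg]
      dsimp only
      linarith
    have h0 : 0 ≤ g y := by
      have := hlow x (interior_subset hx) y
      rw [hg]; dsimp only; linarith
    have : ‖y‖ ≤ g y / (r / 2) := by
      refine (pi_norm_le_iff_of_nonneg (by positivity)).2 fun i => ?_
      rw [le_div_iff₀ (by positivity), mul_comm]
      exact hi i
    rw [le_div_iff₀ (by positivity)] at this
    linarith
  have htend : Filter.Tendsto g (Filter.cocompact _) Filter.atTop :=
    Filter.tendsto_atTop_mono hco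
      (Filter.Tendsto.const_mul_atTop (by positivity) (tendsto_norm_cocompact_atTop))
  obtain ⟨y, hy⟩ := hcont.exists_forall_le htend
  have hmin : IsLocalMin g y := Filter.Eventually.of_forall hy
  have hz := hmin.hasFDerivAt_eq_zero (hderiv y)
  refine ⟨y, ?_⟩
  have h3 : mvL (∑ i ∈ I, mvMean p (A i) y - x) (∑ i ∈ I, mvMean p (A i) y - x) = 0 := by
    rw [hz]; rfl
  rw [mvL_apply, dotProduct_self_eq_zero] at h3
  exact sub_eq_zero.1 h3

lemma mv_inj (hA : ∀ i, (A i).Nonempty) (I : Finset (Fin n))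
    (hpos : ∀ y h : Fin n → ℝ, h ≠ 0 → 0 < h ⬝ᵥ (∑ i ∈ I, mvHess p (A i) y).mulVec h) :
    Function.Injective (fun y => ∑ i ∈ I, mvMean p (A i) y) := by
  intro y z hyz
  by_contra hne
  have hv : z - y ≠ 0 := sub_ne_zero.2 (Ne.symm hne)
  set v := z - y with hvdef
  set φ : ℝ → ℝ := fun s => mvL v (∑ i ∈ I, mvMean p (A i) (y + s • v)) with hφ
  have hline : ∀ s : ℝ, HasDerivAt (fun s : ℝ => y + s • v) v s := by
    intro s
    simpa using ((hasDerivAt_id s).smul_const v).const_add y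
  have hd : ∀ s, HasDerivAt φ (v ⬝ᵥ (∑ i ∈ I, mvHess p (A i) (y + s • v)).mulVec v) s := by
    intro s
    have h1 := (mvF_hasFDerivAt p hA I (y + s • v)).comp_hasDerivAt s (hline s)
    have h2 := (mvL v).hasFDerivAt.comp_hasDerivAt s h1
    rw [← mvL_apply]
    exact h2
  have hmono : StrictMono φ := strictMono_of_deriv_pos fun s => by
    rw [(hd s).deriv]; exact hpos _ _ hv
  have h01 := hmono (zero_lt_one)
  have e0 : φ 0 = mvL v (∑ i ∈ I, mvMean p (A i) y) := by simp [hφ]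
  have e1 : φ 1 = mvL v (∑ i ∈ I, mvMean p (A i) z) := by simp [hφ, hvdef]
  rw [e0, e1] at h01
  simp only at hyz
  rw [hyz] at h01
  exact lt_irrefl _ h01

lemma mv_Q_compact (I : Finset (Fin n)) :
    IsCompact (∑ i ∈ I, convexHull ℝ (p '' (A i : Set α))) := by
  classical
  induction I using Finset.induction_on with
  | empty => simp only [Finset.sum_empty]; exact isCompact_singleton
  | insert i s hi ih =>
    rw [Finset.sum_insert hi]
    exact (((A i).finite_toSet.image p).isCompact_convexHull ℝ).add ih

lemma mv_lintegral (hA : ∀ i, (A i).Nonempty) (I : Finset (Fin n)) :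
    ∫⁻ y, ENNReal.ofReal |(∑ i ∈ I, mvHess p (A i) y).det|
      = MeasureTheory.volume (∑ i ∈ I, convexHull ℝ (p '' (A i : Set α))) := by
  by_cases hdeg : ∃ v : Fin n → ℝ, v ≠ 0 ∧ ∀ i ∈ I, ∀ k ∈ A i ×ˢ A i, mvL (p k.1 - p k.2) v = 0
  · obtain ⟨v, hv, hI⟩ := hdeg
    have h1 : ∀ y, (∑ i ∈ I, mvHess p (A i) y).det = 0 := by
      intro y
      refine Matrix.exists_mulVec_eq_zero_iff.1 ⟨v, hv, ?_⟩
      rw [Matrix.sum_mulVec]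
      refine Finset.sum_eq_zero fun i hi => ?_
      rw [mvHess, Matrix.sum_mulVec]
      refine Finset.sum_eq_zero fun k hk => ?_
      rw [Matrix.smul_mulVec, Matrix.vecMulVec_mulVec, ← mvL_apply, hI i hi k hk]
      simp
    simp only [h1, abs_zero, ENNReal.ofReal_zero, MeasureTheory.lintegral_zero]
    symm
    choose a ha using hA
    set c := ∑ i ∈ I, p (a i) with hc
    have hsub : (∑ i ∈ I, convexHull ℝ (p '' (A i : Set α))) ⊆
        (AffineSubspace.mk' c (LinearMap.ker (mvL v).toLinearMap) : Set (Fin n → ℝ)) := by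
      intro q hq
      obtain ⟨u, hu, rfl⟩ := (Set.mem_finsetSum _ _ _).1 hq
      have hu' : ∀ i ∈ I, mvL v (u i) = mvL v (p (a i)) := by
        intro i hi
        have h : convexHull ℝ (p '' (A i : Set α)) ⊆ {q | mvL v q = mvL v (p (a i))} := by
          refine convexHull_min ?_ (convex_hyperplane (mvL v).toLinearMap.isLinear _)
          rintro _ ⟨b, hb, rfl⟩
          have := hI i hi (b, a i) (Finset.mem_product.2 ⟨hb, ha i⟩)
          rw [mvL_comm, map_sub] at this
          exact sub_eq_zero.1 this
        exact h (hu hi)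
      rw [SetLike.mem_coe, AffineSubspace.mem_mk', LinearMap.mem_ker]
      change mvL v (∑ i ∈ I, u i - c) = 0
      rw [map_sub, hc, map_sum, map_sum, Finset.sum_congr rfl hu', sub_self]
    refine MeasureTheory.measure_mono_null hsub (MeasureTheory.Measure.addHaar_affineSubspace _ _ ?_)
    intro htop
    have h2 : (AffineSubspace.mk' c (LinearMap.ker (mvL v).toLinearMap)).direction = ⊤ := by
      rw [htop, AffineSubspace.direction_top]
    rw [AffineSubspace.direction_mk'] at h2
    have h3 : v ∈ LinearMap.ker (mvL v).toLinearMap := by rw [h2]; trivial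
    rw [LinearMap.mem_ker] at h3
    change mvL v v = 0 at h3
    rw [mvL_apply, dotProduct_self_eq_zero] at h3
    exact hv h3
  · push Not at hdeg
    have hpos : ∀ y h : Fin n → ℝ, h ≠ 0 →
        0 < h ⬝ᵥ (∑ i ∈ I, mvHess p (A i) y).mulVec h := by
      intro y h hh
      obtain ⟨i, hi, k, hk, hne⟩ := hdeg h hh
      rw [mvH_quad]
      have hnn : ∀ (j : Fin n) (k : α × α), 0 ≤ (2⁻¹ * (mvW p (A j) k.1 y * mvW p (A j) k.2 y)) *
          (mvL (p k.1 - p k.2) h) ^ 2 := fun j k =>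
        mul_nonneg (mul_nonneg (by norm_num)
          (mul_pos (mvW_pos _ _ _ _) (mvW_pos _ _ _ _)).le) (sq_nonneg _)
      refine Finset.sum_pos' (fun j _ => Finset.sum_nonneg fun k _ => hnn j k) ⟨i, hi, ?_⟩
      refine Finset.sum_pos' (fun k _ => hnn i k) ⟨k, hk, ?_⟩
      exact mul_pos (mul_pos (by norm_num) (mul_pos (mvW_pos _ _ _ _) (mvW_pos _ _ _ _)))
        (by positivity)
    have hcv := MeasureTheory.lintegral_abs_det_fderiv_eq_addHaar_image MeasureTheory.volume
      MeasurableSet.univ (fun y _ => (mvF_hasFDerivAt p hA I y).hasFDerivWithinAt)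
      (mv_inj p hA I hpos).injOn
    rw [MeasureTheory.Measure.restrict_univ] at hcv
    have hdet : ∀ y, (LinearMap.toContinuousLinearMap
        (Matrix.toLin' (∑ i ∈ I, mvHess p (A i) y))).det = (∑ i ∈ I, mvHess p (A i) y).det := by
      intro y
      rw [LinearMap.det_toContinuousLinearMap, LinearMap.det_toLin']
    simp only [hdet] at hcv
    rw [hcv]
    have hconv : Convex ℝ (∑ i ∈ I, convexHull ℝ (p '' (A i : Set α))) :=
      convex_sum _ fun i _ => convex_convexHull ℝ _
    apply le_antisymm
    · refine MeasureTheory.measure_mono ?_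
      rintro _ ⟨y, _, rfl⟩
      exact (Set.mem_finsetSum _ _ _).2 ⟨_, fun {i} _ => mvMean_mem p (hA i) y, rfl⟩
    · calc MeasureTheory.volume (∑ i ∈ I, convexHull ℝ (p '' (A i : Set α)))
          ≤ MeasureTheory.volume (interior (∑ i ∈ I, convexHull ℝ (p '' (A i : Set α))) ∪
            frontier (∑ i ∈ I, convexHull ℝ (p '' (A i : Set α)))) := by
            refine MeasureTheory.measure_mono ?_
            rw [← closure_eq_interior_union_frontier]
            exact subset_closure
        _ ≤ _ := MeasureTheory.measure_union_le _ _
        _ = MeasureTheory.volume (interior (∑ i ∈ I, convexHull ℝ (p '' (A i : Set α)))) := by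
            rw [hconv.addHaar_frontier MeasureTheory.volume, add_zero]
        _ ≤ _ := by
            refine MeasureTheory.measure_mono ?_
            intro x hx
            obtain ⟨y, hy⟩ := mv_surj p hA I hx
            exact ⟨y, Set.mem_univ _, hy⟩

lemma mvH_det_nonneg (I : Finset (Fin n)) (y : Fin n → ℝ) :
    0 ≤ (∑ i ∈ I, mvHess p (A i) y).det := by
  refine (Matrix.PosSemidef.of_dotProduct_mulVec_nonneg (mvH_symm p I y) fun h => ?_).det_nonneg
  rw [star_trivial, mvH_quad]
  exact Finset.sum_nonneg fun i _ => Finset.sum_nonneg fun k _ =>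
    mul_nonneg (mul_nonneg (by norm_num)
      (mul_pos (mvW_pos _ _ _ _) (mvW_pos _ _ _ _)).le) (sq_nonneg _)

lemma mvH_det_continuous (hA : ∀ i, (A i).Nonempty) (I : Finset (Fin n)) :
    Continuous fun y => (∑ i ∈ I, mvHess p (A i) y).det :=
  (continuous_finsetSum _ fun i _ => mvHess_continuous p (hA i)).matrix_det

lemma mvH_integrable (hA : ∀ i, (A i).Nonempty) (I : Finset (Fin n)) :
    MeasureTheory.Integrable fun y => (∑ i ∈ I, mvHess p (A i) y).det := by
  refine ⟨(mvH_det_continuous p hA I).aestronglyMeasurable, ?_⟩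
  rw [MeasureTheory.hasFiniteIntegral_iff_norm]
  simp only [Real.norm_eq_abs]
  rw [mv_lintegral p hA I]
  exact (mv_Q_compact p I).measure_lt_top

lemma mvH_integral (hA : ∀ i, (A i).Nonempty) (I : Finset (Fin n)) :
    ∫ y, (∑ i ∈ I, mvHess p (A i) y).det
      = (MeasureTheory.volume (∑ i ∈ I, convexHull ℝ (p '' (A i : Set α)))).toReal := by
  rw [MeasureTheory.integral_eq_lintegral_of_nonneg_ae
    (Filter.Eventually.of_forall fun y => mvH_det_nonneg p I y)
    (mvH_det_continuous p hA I).aestronglyMeasurable, ← mv_lintegral p hA I]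
  congr 2
  ext y
  rw [abs_of_nonneg (mvH_det_nonneg p I y)]

/-- The mixed volume does not vanish iff some choice of difference vectors is a basis. -/
lemma mv_main (hA : ∀ i, (A i).Nonempty) :
    (∑ I : Finset (Fin n), (-1 : ℝ) ^ (n - I.card) *
      (MeasureTheory.volume (∑ i ∈ I, convexHull ℝ (p '' (A i : Set α)))).toReal) ≠ 0 ↔
    ∃ k : Fin n → α × α, (∀ i, k i ∈ A i ×ˢ A i) ∧
      (Matrix.of fun i => p (k i).1 - p (k i).2).det ≠ 0 := by
  set G : (Fin n → ℝ) → ℝ := fun y => ∑ k ∈ Fintype.piFinset (fun i => A i ×ˢ A i),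
    (∏ i, (2⁻¹ * (mvW p (A i) (k i).1 y * mvW p (A i) (k i).2 y))) *
      (Matrix.of fun i => p (k i).1 - p (k i).2).det ^ 2 with hG
  have hGeq : ∀ y, (∑ I : Finset (Fin n), (-1 : ℝ) ^ (n - I.card) *
      (∑ i ∈ I, mvHess p (A i) y).det) = G y := fun y =>
    mv_rankone n (fun i => A i ×ˢ A i)
      (fun i k => 2⁻¹ * (mvW p (A i) k.1 y * mvW p (A i) k.2 y)) (fun k => p k.1 - p k.2)
  have hint : ∀ I : Finset (Fin n), MeasureTheory.Integrable fun y =>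
      (-1 : ℝ) ^ (n - I.card) * (∑ i ∈ I, mvHess p (A i) y).det := fun I =>
    (mvH_integrable p hA I).const_mul _
  have hGint : MeasureTheory.Integrable G := by
    have := MeasureTheory.integrable_finsetSum Finset.univ fun I _ => hint I
    exact this.congr (Filter.Eventually.of_forall fun y => by simpa using hGeq y)
  have hval : (∑ I : Finset (Fin n), (-1 : ℝ) ^ (n - I.card) *
      (MeasureTheory.volume (∑ i ∈ I, convexHull ℝ (p '' (A i : Set α)))).toReal) = ∫ y, G y := by
    simp_rw [← hGeq]
    rw [MeasureTheory.integral_finsetSum _ fun I _ => hint I]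
    refine Finset.sum_congr rfl fun I _ => ?_
    rw [MeasureTheory.integral_const_mul, mvH_integral p hA I]
  rw [hval]
  have hw : ∀ y (k : Fin n → α × α),
      0 < ∏ i, (2⁻¹ * (mvW p (A i) (k i).1 y * mvW p (A i) (k i).2 y)) := fun y k =>
    Finset.prod_pos fun i _ => mul_pos (by norm_num) (mul_pos (mvW_pos _ _ _ _) (mvW_pos _ _ _ _))
  constructor
  · intro h
    by_contra! hcon
    apply h
    have : ∀ y, G y = 0 := by
      intro y
      refine Finset.sum_eq_zero fun k hk => ?_
      rw [hcon k (Fintype.mem_piFinset.1 hk)]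
      ring
    simp [this]
  · rintro ⟨k, hk, hdet⟩
    have hpos : ∀ y, 0 < G y := fun y =>
      Finset.sum_pos' (fun k _ => mul_nonneg (hw y k).le (sq_nonneg _))
        ⟨k, Fintype.mem_piFinset.2 hk, mul_pos (hw y k) (by positivity)⟩
    refine ne_of_gt ?_
    rw [MeasureTheory.integral_pos_iff_support_of_nonneg (fun y => (hpos y).le) hGint]
    have : Function.support G = Set.univ := by
      ext y; simp [(hpos y).ne']
    rw [this]
    exact MeasureTheory.Measure.measure_univ_pos.2 (NeZero.ne _)

lemma mv_vectorSpan {a b : Fin n → Fin n → ℝ} :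
    vectorSpan ℝ (∑ i : Fin n, convexHull ℝ {a i, b i})
      = Submodule.span ℝ (Set.range fun i => a i - b i) := by
  classical
  apply le_antisymm
  · rw [vectorSpan_def, Submodule.span_le]
    have key : ∀ q ∈ ∑ i : Fin n, convexHull ℝ {a i, b i},
        q - ∑ i, b i ∈ Submodule.span ℝ (Set.range fun i => a i - b i) := by
      intro q hq
      obtain ⟨u, hu, rfl⟩ := (Set.mem_finsetSum _ _ _).1 hq
      rw [← Finset.sum_sub_distrib]
      refine Submodule.sum_mem _ fun i _ => ?_
      have h := hu (Finset.mem_univ i)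
      rw [convexHull_pair] at h
      obtain ⟨s, t, hs, ht, hst, hx⟩ := h
      have : u i - b i = s • (a i - b i) := by
        rw [← hx]
        have : t = 1 - s := by linarith
        subst this
        module
      rw [this]
      exact Submodule.smul_mem _ _ (Submodule.subset_span ⟨i, rfl⟩)
    rintro _ ⟨x, hx, y, hy, rfl⟩
    have := Submodule.sub_mem _ (key x hx) (key y hy)
    simpa using this
  · rw [Submodule.span_le]
    rintro _ ⟨i, rfl⟩
    have h1 : ∑ j, b j ∈ ∑ i : Fin n, convexHull ℝ {a i, b i} :=
      (Set.mem_finsetSum _ _ _).2 ⟨b, fun {j} _ => subset_convexHull ℝ _ (by simp), rfl⟩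
    have h2 : ∑ j, Function.update b i (a i) j ∈ ∑ i : Fin n, convexHull ℝ {a i, b i} := by
      refine (Set.mem_finsetSum _ _ _).2 ⟨_, fun {j} _ => subset_convexHull ℝ _ ?_, rfl⟩
      by_cases h : j = i
      · subst h; simp
      · simp [h]
    have h3 := vsub_mem_vectorSpan ℝ h2 h1
    have h4 : (∑ j, Function.update b i (a i) j) -ᵥ ∑ j, b j = a i - b i := by
      rw [vsub_eq_sub, ← Finset.sum_sub_distrib, Finset.sum_eq_single i]
      · simp
      · intro j _ hj; simp [hj]
      · simp
    rw [h4] at h3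
    exact h3

lemma mv_finrank {a b : Fin n → Fin n → ℝ} :
    Module.finrank ℝ (vectorSpan ℝ (∑ i : Fin n, convexHull ℝ {a i, b i})) = n ↔
      (Matrix.of fun i => a i - b i).det ≠ 0 := by
  rw [mv_vectorSpan, ← isUnit_iff_ne_zero, ← Matrix.isUnit_iff_isUnit_det,
    ← Matrix.linearIndependent_rows_iff_isUnit, linearIndependent_iff_card_eq_finrank_span,
    Fintype.card_fin, eq_comm]
  rfl

end bodies

/-- Nonvanishing of the mixed volume via independent segments (Bernstein/Minkowski
criterion, equivalently codimension zero of the associated resultant): the mixed volume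
of the convex hulls of `A 1, ..., A n ⊆ ℤ^n` is nonzero iff one can choose a
two-element subset `E i ⊆ A i` for each `i` such that the Minkowski sum of the segments
`conv (E 1) + ⋯ + conv (E n)` is `n`-dimensional. -/
theorem mixedVol_ne_zero_iff_segments (n : ℕ) (A : Fin n → Finset (Fin n → ℤ))
    (hA : ∀ i, 2 ≤ (A i).card) :
    mixedVol n A ≠ 0 ↔
    ∃ E : Fin n → Finset (Fin n → ℤ), (∀ i, E i ⊆ A i ∧ (E i).card = 2) ∧
      Module.finrank ℝ ↥(vectorSpan ℝ
        (∑ i : Fin n,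
          convexHull ℝ ((fun v : Fin n → ℤ => fun t => (v t : ℝ)) '' ↑(E i)))) = n := by
  classical
  have hne : ∀ i, (A i).Nonempty := fun i => Finset.card_pos.1 (by have := hA i; omega)
  have hmain := mv_main (fun v : Fin n → ℤ => fun t => (v t : ℝ)) hne
  rw [mixedVol, hmain]
  constructor
  · rintro ⟨k, hk, hdet⟩
    refine ⟨fun i => {(k i).1, (k i).2}, fun i => ⟨?_, ?_⟩, ?_⟩
    · have := Finset.mem_product.1 (hk i)
      intro x hx
      rcases Finset.mem_insert.1 hx with rfl | hx
      · exact this.1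
      · rw [Finset.mem_singleton.1 hx]; exact this.2
    · refine Finset.card_pair fun h => hdet ?_
      refine Matrix.det_eq_zero_of_row_eq_zero i fun j => ?_
      simp [h]
    · rw [← mv_finrank] at hdet
      have e : ∀ i, (fun v : Fin n → ℤ => fun t => (v t : ℝ)) ''
          (({(k i).1, (k i).2} : Finset (Fin n → ℤ)) : Set (Fin n → ℤ))
          = {(fun t => ((k i).1 t : ℝ)), (fun t => ((k i).2 t : ℝ))} := fun i => by
        rw [Finset.coe_pair, Set.image_pair]
      rw [Finset.sum_congr rfl fun i _ => congrArg (convexHull ℝ) (e i)]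
      exact hdet
  · rintro ⟨E, hE, hrank⟩
    choose x y hxy hEq using fun i => Finset.card_eq_two.1 (hE i).2
    refine ⟨fun i => (x i, y i), fun i => ?_, ?_⟩
    · have h := (hE i).1
      rw [hEq i] at h
      exact Finset.mem_product.2 ⟨h (by simp), h (by simp)⟩
    · rw [← mv_finrank]
      have e : ∀ i, (fun v : Fin n → ℤ => fun t => (v t : ℝ)) '' ((E i : Set (Fin n → ℤ)))
          = {(fun t => (x i t : ℝ)), (fun t => (y i t : ℝ))} := fun i => by
        rw [hEq i, Finset.coe_pair, Set.image_pair]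
      rw [Finset.sum_congr rfl fun i _ => congrArg (convexHull ℝ) (e i)] at hrank
      exact hrank
end
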